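/- arXiv:2507.07976 — 8 statements merged into one kernel-verified Lean document; each statement's English description precedes it below -/
import Mathlib

section
/- Let π₁,…,π_b ∈ ℝ[x₁,…,x_n] be nonconstant polynomials of degree one inducing a hyperplane partition of ℝⁿ, and let f : ℝⁿ → ℝ be a spline of degree d on this partition. Then f is a finite lattice combination of polynomials: there exist p, p' ∈ ℕ and polynomials f_{ij} ∈ ℝ[x₁,…,x_n] (1 ≤ i ≤ p, 1 ≤ j ≤ p') such that f(x) = max_{i=1,…,p} min_{j=1,…,p'} f_{ij}(x) for all x ∈ ℝⁿ. -/
open MvPolynomial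

/-- The piece of the partition of `ℝⁿ` induced by the polynomials `π`
corresponding to the sign vector `θ ∈ {-1,0,1}^b`. -/
def piece {n b : ℕ} (π : Fin b → MvPolynomial (Fin n) ℝ)
    (θ : Fin b → SignType) : Set (Fin n → ℝ) :=
  {x | ∀ i, SignType.sign (eval x (π i)) = θ i}

/-- `f : ℝⁿ → ℝ` is a spline of degree `d` on the partition induced by `π`:
`f` is continuous and restricts to a polynomial of degree at most `d` on
every nonempty piece. -/
def IsSpline {n b : ℕ} (π : Fin b → MvPolynomial (Fin n) ℝ) (d : ℕ)
    (f : (Fin n → ℝ) → ℝ) : Prop :=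
  Continuous f ∧ ∀ θ : Fin b → SignType, (piece π θ).Nonempty →
    ∃ g : MvPolynomial (Fin n) ℝ, g.totalDegree ≤ d ∧ ∀ x ∈ piece π θ, f x = eval x g

open Filter Topology

/-- A polynomial vanishing near a point is zero. -/
lemma poly_eq_zero_of_eventually {n : ℕ} (p : MvPolynomial (Fin n) ℝ) (z : Fin n → ℝ)
    (h : ∀ᶠ x in 𝓝 z, eval x p = 0) : p = 0 := by
  obtain ⟨ε, hε, hb⟩ := Metric.eventually_nhds_iff_ball.1 h
  refine MvPolynomial.funext_set (fun i => Metric.ball (z i) ε) (fun i => ?_) ?_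
  · rw [Real.ball_eq_Ioo]
    exact Set.Ioo_infinite (by linarith)
  · intro x hx
    rw [map_zero]
    apply hb
    rw [ball_pi _ hε]
    exact hx

/-- A polynomial of total degree at most one is an affine function. -/
lemma affine_of_totalDegree {n : ℕ} (p : MvPolynomial (Fin n) ℝ) (hp : p.totalDegree ≤ 1) :
    ∃ (l : (Fin n → ℝ) →ₗ[ℝ] ℝ) (c : ℝ), ∀ x, eval x p = l x + c := by
  classical
  have key : ∀ s : Finset (Fin n →₀ ℕ), s ⊆ p.support →
      ∃ (l : (Fin n → ℝ) →ₗ[ℝ] ℝ) (c : ℝ),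
        ∀ x : Fin n → ℝ, ∑ m ∈ s, coeff m p * ∏ i, x i ^ m i = l x + c := by
    intro s
    induction s using Finset.induction_on with
    | empty => intro _; exact ⟨0, 0, by simp⟩
    | insert m s hm ih =>
      intro hs
      obtain ⟨l, c, h⟩ := ih (fun a ha => hs (Finset.mem_insert_of_mem ha))
      have hd := (le_totalDegree (hs (Finset.mem_insert_self m s))).trans hp
      rw [Finsupp.sum_fintype _ _ (by simp)] at hd
      by_cases h0 : ∀ i, m i = 0
      · refine ⟨l, coeff m p + c, fun x => ?_⟩
        rw [Finset.sum_insert hm, h]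
        simp [h0]; ring
      · push Not at h0
        obtain ⟨k, hk⟩ := h0
        rw [← Finset.add_sum_erase _ _ (Finset.mem_univ k)] at hd
        have hk1 : m k = 1 := by omega
        have hz : ∑ i ∈ Finset.univ.erase k, m i = 0 := by omega
        rw [Finset.sum_eq_zero_iff] at hz
        refine ⟨coeff m p • LinearMap.proj k + l, c, fun x => ?_⟩
        rw [Finset.sum_insert hm, h, ← Finset.mul_prod_erase _ _ (Finset.mem_univ k),
          Finset.prod_eq_one (s := Finset.univ.erase k)
            (fun i hi => by rw [hz i hi, pow_zero]), hk1]
        simp; ring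
  obtain ⟨l, c, h⟩ := key p.support subset_rfl
  exact ⟨l, c, fun x => by rw [eval_eq', h]⟩

/-- A polynomial vanishing near a point of an affine flat, on the flat, is in the ideal generated
by the affine equations of the flat. -/
lemma mem_span_of_flat {n : ℕ} {ι : Type} [Fintype ι] (π : ι → MvPolynomial (Fin n) ℝ)
    (l : ι → (Fin n → ℝ) →ₗ[ℝ] ℝ) (c : ι → ℝ) (hl : ∀ i x, eval x (π i) = l i x + c i)
    (z : Fin n → ℝ) (hz : ∀ i, eval z (π i) = 0) (h : MvPolynomial (Fin n) ℝ)
    (hh : ∀ᶠ x in 𝓝 z, (∀ i, eval x (π i) = 0) → eval x h = 0) :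
    h ∈ Ideal.span (Set.range π) := by
  classical
  set K : Submodule ℝ (Fin n → ℝ) := ⨅ i, LinearMap.ker (l i) with hK
  obtain ⟨P, hP⟩ := K.subtype.exists_leftInverse_of_injective K.ker_subtype
  have hP' : ∀ v : K, P v = v := fun v => by
    simpa using LinearMap.congr_fun hP v
  have hD : ∀ k : Fin n, ∃ a : ι → ℝ, ∀ v : Fin n → ℝ,
      ∑ i, a i * l i v = v k - (P v : Fin n → ℝ) k := by
    intro k
    have := mem_span_of_iInf_ker_le_ker (L := l)
      (K := LinearMap.proj k - (LinearMap.proj k).comp (K.subtype.comp P)) (by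
        intro v hv
        have := hP' ⟨v, hv⟩
        simp only at this
        simp [this])
    obtain ⟨a, ha⟩ := (Submodule.mem_span_range_iff_exists_fun ℝ).1 this
    refine ⟨a, fun v => ?_⟩
    have := LinearMap.congr_fun ha v
    simpa using this
  choose a ha using hD
  let R : Fin n → MvPolynomial (Fin n) ℝ := fun k => X k - ∑ i, C (a k i) * π i
  have hlz : ∀ i x, eval x (π i) = l i (x - z) := by
    intro i x
    have h1 := hl i x
    have h2 := hl i z
    rw [hz] at h2
    rw [map_sub]; linarith
  have hR : ∀ x k, eval x (R k) = z k + (P (x - z) : Fin n → ℝ) k := by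
    intro x k
    simp only [R, map_sub, map_sum, map_mul, eval_C, eval_X]
    simp only [hlz, ha]
    rw [Pi.sub_apply, map_sub P]; ring
  have hbind : bind₁ R h = 0 := by
    apply poly_eq_zero_of_eventually _ z
    have hcont : Continuous (fun x : Fin n → ℝ => fun k => eval x (R k)) :=
      continuous_pi fun k => MvPolynomial.continuous_eval _
    have ht := hcont.tendsto z
    have hzz : (fun k => eval z (R k)) = z := by
      funext k; simp [hR]
    simp only [hzz] at ht
    filter_upwards [ht.eventually hh] with x hx
    have : eval x (bind₁ R h) = eval (fun k => eval x (R k)) h := by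
      simp only [eval, ← coe_eval₂Hom, eval₂Hom_bind₁]
    rw [this]
    apply hx
    intro i
    rw [hlz]
    have : (fun k => eval x (R k)) - z = (P (x - z) : Fin n → ℝ) := by
      funext k; simp [hR]
    rw [this]
    have hm := (P (x - z)).2
    exact (Submodule.mem_iInf _).1 hm i
  set I := Ideal.span (Set.range π) with hI
  have heq : (Ideal.Quotient.mkₐ ℝ I).comp (bind₁ R) = Ideal.Quotient.mkₐ ℝ I := by
    apply MvPolynomial.algHom_ext
    intro k
    simp only [AlgHom.comp_apply, bind₁_X_right, Ideal.Quotient.mkₐ_eq_mk]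
    rw [Ideal.Quotient.eq]
    have : R k - X k = - ∑ i, C (a k i) * π i := by simp [R]
    rw [this]
    exact I.neg_mem (I.sum_mem fun i _ => I.mul_mem_left _ (Ideal.subset_span ⟨i, rfl⟩))
  have := DFunLike.congr_fun heq h
  simp only [AlgHom.comp_apply, hbind, map_zero, Ideal.Quotient.mkₐ_eq_mk] at this
  exact Ideal.Quotient.eq_zero_iff_mem.1 this.symm

/-- The sign vector of a point. -/
noncomputable def sgnv {n b : ℕ} (π : Fin b → MvPolynomial (Fin n) ℝ) (x : Fin n → ℝ) :
    Fin b → SignType := fun i => SignType.sign (eval x (π i))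

lemma sign_eq_of_mul_pos {u v : ℝ} (h : 0 < u * v) : SignType.sign u = SignType.sign v := by
  rcases pos_and_pos_or_neg_and_neg_of_mul_pos h with ⟨h1, h2⟩ | ⟨h1, h2⟩
  · rw [sign_pos h1, sign_pos h2]
  · rw [sign_neg h1, sign_neg h2]

/-- On boundary points of a cell, `f` agrees with the polynomial of the cell. -/
lemma boundary_eq {n b : ℕ} (π : Fin b → MvPolynomial (Fin n) ℝ)
    (l : Fin b → (Fin n → ℝ) →ₗ[ℝ] ℝ) (c : Fin b → ℝ) (hl : ∀ i x, eval x (π i) = l i x + c i)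
    (f : (Fin n → ℝ) → ℝ) (hf : Continuous f) (G : (Fin b → SignType) → MvPolynomial (Fin n) ℝ)
    (hG : ∀ x, f x = eval x (G (sgnv π x))) (S : Set (Fin b)) (z z' u : Fin n → ℝ)
    (hu : ∀ i, eval u (π i) ≠ 0)
    (hz : ∀ i ∈ S, eval z (π i) = 0) (hz' : ∀ i ∈ S, eval z' (π i) = 0)
    (hn : ∀ i ∉ S, 0 < eval z' (π i) * eval u (π i)) :
    f z' = eval z' (G (sgnv π u)) := by
  have hc : Continuous (fun s : ℝ => z' + s • (u - z)) := by fun_prop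
  have hev : ∀ᶠ s : ℝ in 𝓝[>] 0, sgnv π (z' + s • (u - z)) = sgnv π u := by
    have : ∀ i, ∀ᶠ s : ℝ in 𝓝[>] 0, 0 < eval (z' + s • (u - z)) (π i) * eval u (π i) := by
      intro i
      by_cases hi : i ∈ S
      · filter_upwards [self_mem_nhdsWithin] with s hs
        have hs : 0 < s := hs
        have : eval (z' + s • (u - z)) (π i) = s * eval u (π i) := by
          have h1 := hz i hi
          have h2 := hz' i hi
          rw [hl] at h1 h2 ⊢
          rw [hl, map_add, map_smul, map_sub, smul_eq_mul]
          linear_combination h2 - s * h1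
        rw [this, mul_assoc]
        exact mul_pos hs (mul_self_pos.2 (hu i))
      · have hcc : Continuous (fun s : ℝ => eval (z' + s • (u - z)) (π i) * eval u (π i)) :=
          ((MvPolynomial.continuous_eval _).comp hc).mul continuous_const
        have := hcc.tendsto 0
        simp only [zero_smul, add_zero] at this
        exact (this.eventually_const_lt (hn i hi)).filter_mono nhdsWithin_le_nhds
    filter_upwards [eventually_all.2 this] with s hs
    funext i
    exact sign_eq_of_mul_pos (hs i)
  have t1 : Tendsto (fun s : ℝ => f (z' + s • (u - z))) (𝓝[>] 0) (𝓝 (f z')) := by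
    have := ((hf.comp hc).tendsto 0).mono_left (nhdsWithin_le_nhds (s := Set.Ioi 0))
    simpa [Function.comp_def] using this
  have t2 : Tendsto (fun s : ℝ => eval (z' + s • (u - z)) (G (sgnv π u))) (𝓝[>] 0)
      (𝓝 (eval z' (G (sgnv π u)))) := by
    have := (((MvPolynomial.continuous_eval (G (sgnv π u))).comp hc).tendsto 0).mono_left
      (nhdsWithin_le_nhds (s := Set.Ioi 0))
    simpa [Function.comp_def] using this
  refine tendsto_nhds_unique (t1.congr' ?_) t2
  filter_upwards [hev] with s hs
  rw [hG, hs]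

/-- The difference of two cell polynomials is in the ideal generated by the separating
hyperplanes. -/
lemma diff_mem {n b : ℕ} (π : Fin b → MvPolynomial (Fin n) ℝ)
    (l : Fin b → (Fin n → ℝ) →ₗ[ℝ] ℝ) (c : Fin b → ℝ) (hl : ∀ i x, eval x (π i) = l i x + c i)
    (f : (Fin n → ℝ) → ℝ) (hf : Continuous f) (G : (Fin b → SignType) → MvPolynomial (Fin n) ℝ)
    (hG : ∀ x, f x = eval x (G (sgnv π x))) (N : ℕ) :
    ∀ x y : Fin n → ℝ, (∀ i, eval x (π i) ≠ 0) → (∀ i, eval y (π i) ≠ 0) →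
    {i | eval x (π i) * eval y (π i) < 0}.ncard ≤ N →
    G (sgnv π y) - G (sgnv π x) ∈ Ideal.span (π '' {i | eval x (π i) * eval y (π i) < 0}) := by
  classical
  induction N with
  | zero =>
    intro x y hx hy hN
    have h0 : {i | eval x (π i) * eval y (π i) < 0} = ∅ := by
      rw [← Set.ncard_eq_zero]; omega
    have : sgnv π y = sgnv π x := by
      funext i
      refine (sign_eq_of_mul_pos ?_).symm
      have h1 : i ∉ {i | eval x (π i) * eval y (π i) < 0} := by rw [h0]; simp
      exact lt_of_le_of_ne (not_lt.1 h1) (mul_ne_zero (hx i) (hy i)).symm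
    rw [this, sub_self]
    exact Ideal.zero_mem _
  | succ N ih =>
    intro x y hx hy hN
    set S0 : Set (Fin b) := {i | eval x (π i) * eval y (π i) < 0} with hS0
    by_cases hne : S0.Nonempty
    swap
    · exact ih x y hx hy (by
        rw [Set.not_nonempty_iff_eq_empty] at hne
        rw [← hS0, hne]; simp)
    let A : Fin b → ℝ := fun i => eval x (π i)
    let B : Fin b → ℝ := fun i => eval y (π i)
    let T : Fin b → ℝ := fun i => A i / (A i - B i)
    have hseg : ∀ (t : ℝ) i, eval (x + t • (y - x)) (π i) = A i - t * (A i - B i) := by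
      intro t i
      simp only [A, B, hl, map_add, map_smul, map_sub, smul_eq_mul]
      ring
    obtain ⟨i0, hi0, hmin⟩ := Set.exists_min_image S0 T S0.toFinite hne
    set t0 := T i0 with ht0
    have hT : ∀ i ∈ S0, A i * A i - T i * (A i * A i - A i * B i) = 0 ∧
        0 < A i * A i - A i * B i := by
      intro i hi
      have h1 : A i * B i < 0 := hi
      have h2 : A i - B i ≠ 0 := by
        intro h
        have : A i = B i := by linarith
        rw [this] at h1
        nlinarith [mul_self_nonneg (B i)]
      refine ⟨?_, by nlinarith [mul_self_nonneg (A i)]⟩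
      simp only [T]
      field_simp
      ring
    have hAA : ∀ i, 0 < A i * A i := fun i => mul_self_pos.2 (hx i)
    have ht0pos : 0 ≤ t0 := by
      have ⟨h1, h2⟩ := hT i0 hi0
      have := hAA i0
      by_contra hlt
      push Not at hlt
      nlinarith
    have ht0lt : t0 < 1 := by
      have ⟨h1, h2⟩ := hT i0 hi0
      have h3 : A i0 * B i0 < 0 := hi0
      by_contra hlt
      push Not at hlt
      nlinarith
    let S : Set (Fin b) := {i | i ∈ S0 ∧ T i = t0}
    set z := x + t0 • (y - x) with hz
    have hzS : ∀ i ∈ S, eval z (π i) = 0 := by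
      intro i hi
      have ⟨h1, _⟩ := hT i hi.1
      rw [hi.2] at h1
      have : A i * eval z (π i) = 0 := by rw [hz, hseg]; linarith
      exact (mul_eq_zero.1 this).resolve_left (hx i)
    have hznS : ∀ i ∉ S, 0 < eval z (π i) * A i := by
      intro i hi
      rw [hz, hseg]
      by_cases h : i ∈ S0
      · have ⟨h1, h2⟩ := hT i h
        have h3 : t0 < T i := lt_of_le_of_ne (hmin i h) (fun e => hi ⟨h, e.symm⟩)
        nlinarith
      · have h3 : 0 ≤ A i * B i := not_lt.1 h
        have := hAA i
        nlinarith
    -- choose `w` just after the crossing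
    have hev : ∀ i, ∀ᶠ t : ℝ in 𝓝[>] t0,
        (i ∈ S → eval (x + t • (y - x)) (π i) * A i < 0) ∧
        (i ∉ S → 0 < eval (x + t • (y - x)) (π i) * A i) := by
      intro i
      by_cases hi : i ∈ S
      · filter_upwards [self_mem_nhdsWithin] with t ht
        have ht : t0 < t := ht
        refine ⟨fun _ => ?_, fun h => absurd hi h⟩
        have ⟨h1, h2⟩ := hT i hi.1
        rw [hi.2] at h1
        rw [hseg]
        nlinarith
      · have hcc : Continuous (fun t : ℝ => eval (x + t • (y - x)) (π i) * A i) :=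
          ((MvPolynomial.continuous_eval _).comp (by fun_prop)).mul continuous_const
        have := (hcc.tendsto t0).eventually_const_lt (hznS i hi)
        filter_upwards [this.filter_mono nhdsWithin_le_nhds] with t ht
        exact ⟨fun h => absurd h hi, fun _ => ht⟩
    obtain ⟨t, ht⟩ := (eventually_all.2 hev).exists
    set w := x + t • (y - x) with hw
    have hwne : ∀ i, eval w (π i) ≠ 0 := by
      intro i h0
      by_cases hi : i ∈ S
      · have := (ht i).1 hi; rw [h0] at this; simp at this
      · have := (ht i).2 hi; rw [h0] at this; simp at this
    have hwy : {i | eval w (π i) * eval y (π i) < 0} = S0 \ S := by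
      ext i
      have hAi := hAA i
      have e1 : (eval w (π i) * B i) * (A i * A i) = (eval w (π i) * A i) * (A i * B i) := by ring
      constructor
      · intro h
        have h : eval w (π i) * B i < 0 := h
        have hneg := mul_neg_of_neg_of_pos h hAi
        rw [e1] at hneg
        by_cases hi : i ∈ S
        · have h1 := (ht i).1 hi
          have h2 : A i * B i < 0 := hi.1
          exact absurd (mul_pos_of_neg_of_neg h1 h2) (not_lt.2 hneg.le)
        · refine ⟨?_, hi⟩
          have h1 := (ht i).2 hi
          by_contra h2
          have h2 : 0 ≤ A i * B i := not_lt.1 h2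
          exact absurd hneg (not_lt.2 (mul_nonneg h1.le h2))
      · rintro ⟨h1, h2⟩
        have h1 : A i * B i < 0 := h1
        have h3 := (ht i).2 h2
        have h4 := mul_neg_of_pos_of_neg h3 h1
        rw [← e1] at h4
        change eval w (π i) * B i < 0
        by_contra h5
        exact absurd h4 (not_lt.2 (mul_nonneg (not_lt.1 h5) hAi.le))
    have hSsub : S ⊆ S0 := fun i hi => hi.1
    have hstep1 : G (sgnv π y) - G (sgnv π w) ∈ Ideal.span (π '' S0) := by
      have hlt : (S0 \ S).ncard < S0.ncard :=
        Set.ncard_lt_ncard ⟨Set.sdiff_subset, fun h => (h hi0).2 ⟨hi0, rfl⟩⟩ S0.toFinite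
      have := ih w y hwne hy (by rw [hwy]; omega)
      rw [hwy] at this
      exact Ideal.span_mono (Set.image_mono Set.sdiff_subset) this
    have hstep2 : G (sgnv π w) - G (sgnv π x) ∈ Ideal.span (π '' S0) := by
      have hm := mem_span_of_flat (fun i : S => π i) (fun i => l i) (fun i => c i)
        (fun i x => hl i x) z (fun i => hzS i i.2) (G (sgnv π w) - G (sgnv π x)) (by
          have hnear : ∀ i, ∀ᶠ z' in 𝓝 z, i ∉ S → 0 < eval z' (π i) * A i := by
            intro i
            by_cases hi : i ∈ S
            · exact Eventually.of_forall fun _ h => absurd hi h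
            · have hcc : Continuous (fun z' : Fin n → ℝ => eval z' (π i) * A i) :=
                (MvPolynomial.continuous_eval _).mul continuous_const
              filter_upwards [(hcc.tendsto z).eventually_const_lt (hznS i hi)] with z' h _
              exact h
          filter_upwards [eventually_all.2 hnear] with z' hz' hflat
          have e1 := boundary_eq π l c hl f hf G hG S z z' x hx hzS
            (fun i hi => hflat ⟨i, hi⟩) (fun i hi => hz' i hi)
          have e2 := boundary_eq π l c hl f hf G hG S z z' w hwne hzS
            (fun i hi => hflat ⟨i, hi⟩) (fun i hi => by
              have h1 := hz' i hi
              have h2 := (ht i).2 hi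
              have h3 := mul_pos h1 h2
              have e : eval z' (π i) * A i * (eval w (π i) * A i)
                = (eval z' (π i) * eval w (π i)) * (A i * A i) := by ring
              rw [e] at h3
              exact pos_of_mul_pos_left h3 (hAA i).le)
          rw [map_sub, ← e1, ← e2, sub_self])
      refine Ideal.span_mono ?_ hm
      rintro _ ⟨i, rfl⟩
      exact ⟨i, hSsub i.2, rfl⟩
    have := Ideal.add_mem _ hstep1 hstep2
    simpa using this

/-- Separating polynomial for a pair of cells. -/
lemma exists_sep {n b : ℕ} (π : Fin b → MvPolynomial (Fin n) ℝ)
    (x y : Fin n → ℝ) (g h : MvPolynomial (Fin n) ℝ)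
    (hm : h - g ∈ Ideal.span (π '' {i | eval x (π i) * eval y (π i) < 0})) :
    ∃ e : MvPolynomial (Fin n) ℝ,
      (∀ u, sgnv π u = sgnv π x → eval u e ≤ eval u g) ∧
      (∀ u, sgnv π u = sgnv π y → eval u h ≤ eval u e) := by
  classical
  rw [Set.image_eq_range] at hm
  obtain ⟨q, hq⟩ := (Submodule.mem_span_range_iff_exists_fun _).1 hm
  let E : {i | eval x (π i) * eval y (π i) < 0} → MvPolynomial (Fin n) ℝ :=
    fun i => C (eval y (π i)) * π i
  let Q : {i | eval x (π i) * eval y (π i) < 0} → MvPolynomial (Fin n) ℝ :=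
    fun i => C (eval y (π i))⁻¹ * q i
  have hy : ∀ i : {i | eval x (π i) * eval y (π i) < 0}, eval y (π i) ≠ 0 := by
    intro i h0
    have : eval x (π i) * eval y (π i) < 0 := i.2
    simp [h0] at this
  have hsame : ∀ u v, sgnv π u = sgnv π v → ∀ i, eval v (π i) ≠ 0 →
      0 < eval u (π i) * eval v (π i) := by
    intro u v huv i hv
    have h1 : SignType.sign (eval u (π i)) = SignType.sign (eval v (π i)) := congrFun huv i
    rcases lt_or_gt_of_ne hv with h | h
    · rw [sign_neg h, sign_eq_neg_one_iff] at h1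
      exact mul_pos_of_neg_of_neg h1 h
    · rw [sign_pos h, sign_eq_one_iff] at h1
      exact mul_pos h1 h
  refine ⟨g + ∑ i, E i * (1 + Q i ^ 2), fun u hu => ?_, fun u hu => ?_⟩
  · rw [map_add, map_sum]
    have : ∑ i, eval u (E i * (1 + Q i ^ 2)) ≤ 0 := by
      refine Finset.sum_nonpos fun i _ => ?_
      have hi : eval x (π i) * eval y (π i) < 0 := i.2
      have hxi : eval x (π i) ≠ 0 := by
        intro h0; simp [h0] at hi
      have h1 := hsame u x hu i hxi
      have h2 : eval y (π i) * eval u (π i) < 0 := by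
        by_contra hcon
        have hcon := not_lt.1 hcon
        have h3 := mul_neg_of_pos_of_neg h1 hi
        have h4 : eval u (π i) * eval x (π i) * (eval x (π i) * eval y (π i))
          = (eval y (π i) * eval u (π i)) * (eval x (π i) * eval x (π i)) := by ring
        rw [h4] at h3
        exact absurd h3 (not_lt.2 (mul_nonneg hcon (mul_self_nonneg _)))
      simp only [E, map_mul, map_add, map_pow, map_one, eval_C]
      exact mul_nonpos_of_nonpos_of_nonneg h2.le (by positivity)
    linarith
  · have hh : h = g + ∑ i, E i * Q i := by
      have : ∑ i, E i * Q i = h - g := by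
        rw [← hq]
        refine Finset.sum_congr rfl fun i _ => ?_
        have : C (eval y (π i)) * C (eval y (π i))⁻¹ = (1 : MvPolynomial (Fin n) ℝ) := by
          rw [← C_mul, mul_inv_cancel₀ (hy i), C_1]
        simp only [E, Q, smul_eq_mul]
        linear_combination (π i * q i) * this
      rw [this]; ring
    rw [hh, map_add, map_add, map_sum, map_sum]
    gcongr with i _
    rw [map_mul _ (E i) (Q i), map_mul _ (E i) (1 + Q i ^ 2)]
    have h1 := hsame u y hu i (hy i)
    have h2 : 0 ≤ eval u (E i) := by
      simp only [E, map_mul, eval_C]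
      linarith
    apply mul_le_mul_of_nonneg_left _ h2
    simp only [map_add, map_pow, map_one]
    nlinarith [sq_nonneg (eval u (Q i) - 1), sq_nonneg (eval u (Q i))]

/-- Pierce–Birkhoff conjecture for splines: every spline on a hyperplane
partition is a finite lattice combination of polynomials. -/
theorem pierce_birkhoff_for_splines {n b d : ℕ}
    (π : Fin b → MvPolynomial (Fin n) ℝ) (hπ : ∀ i, (π i).totalDegree = 1)
    (f : (Fin n → ℝ) → ℝ) (hf : IsSpline π d f) :
    ∃ (p p' : ℕ) (F : Fin (p + 1) → Fin (p' + 1) → MvPolynomial (Fin n) ℝ),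
      ∀ x : Fin n → ℝ,
        f x = Finset.univ.sup' Finset.univ_nonempty (fun i =>
          Finset.univ.inf' Finset.univ_nonempty (fun j => eval x (F i j))) := by
  classical
  obtain ⟨hfc, hfp⟩ := hf
  choose l c hl using fun i => affine_of_totalDegree (π i) (hπ i).le
  have hG0 : ∀ θ : Fin b → SignType, ∃ g : MvPolynomial (Fin n) ℝ,
      ∀ x ∈ piece π θ, f x = eval x g := by
    intro θ
    by_cases h : (piece π θ).Nonempty
    · obtain ⟨g, _, hg⟩ := hfp θ h
      exact ⟨g, hg⟩
    · exact ⟨0, fun x hx => absurd ⟨x, hx⟩ h⟩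
  choose G hG1 using hG0
  have hG : ∀ x, f x = eval x (G (sgnv π x)) := fun x => hG1 _ x (fun _ => rfl)
  -- generic points are dense
  have hdense : Dense {x : Fin n → ℝ | ∀ i, eval x (π i) ≠ 0} := by
    intro z
    rw [mem_closure_iff_frequently]
    intro hcon
    have : (∏ i, π i) = 0 := by
      apply poly_eq_zero_of_eventually _ z
      filter_upwards [hcon] with x hx
      have hx : ¬ ∀ i, eval x (π i) ≠ 0 := hx
      push Not at hx
      obtain ⟨i, hi⟩ := hx
      rw [map_prod]
      exact Finset.prod_eq_zero (Finset.mem_univ i) hi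
    obtain ⟨i, _, hi⟩ := Finset.prod_eq_zero_iff.1 this
    have := hπ i
    rw [hi] at this
    simp at this
  let Θ := {θ : Fin b → SignType // ∃ x, (∀ i, eval x (π i) ≠ 0) ∧ sgnv π x = θ}
  have hΘ : Nonempty Θ := by
    obtain ⟨x, hx⟩ := hdense.nonempty
    exact ⟨⟨sgnv π x, x, hx, rfl⟩⟩
  have hsep : ∀ φ θ : Θ, ∃ e : MvPolynomial (Fin n) ℝ,
      (∀ u, sgnv π u = θ.1 → eval u e ≤ f u) ∧ (∀ u, sgnv π u = φ.1 → f u ≤ eval u e) := by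
    rintro ⟨_, y, hy, rfl⟩ ⟨_, x, hx, rfl⟩
    obtain ⟨e, h1, h2⟩ := exists_sep π x y (G (sgnv π x)) (G (sgnv π y))
      (diff_mem π l c hl f hfc G hG _ x y hx hy le_rfl)
    refine ⟨e, fun u hu => ?_, fun u hu => ?_⟩
    · rw [hG, hu]; exact h1 u hu
    · rw [hG, hu]; exact h2 u hu
  choose e he1 he2 using hsep
  obtain ⟨p, hp⟩ : ∃ p, Fintype.card Θ = p + 1 :=
    Nat.exists_eq_succ_of_ne_zero Fintype.card_ne_zero
  let k : Θ ≃ Fin (p + 1) := Fintype.equivFinOfCardEq hp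
  refine ⟨p, p, fun i j => e (k.symm i) (k.symm j), ?_⟩
  refine congrFun (Continuous.ext_on hdense hfc ?_ ?_)
  · refine Continuous.finset_sup'_apply _ fun i _ => Continuous.finset_inf'_apply _ fun j _ => ?_
    exact MvPolynomial.continuous_eval _
  · intro x hx
    let θ : Θ := ⟨sgnv π x, x, hx, rfl⟩
    apply le_antisymm
    · refine le_trans ?_ (Finset.le_sup' _ (Finset.mem_univ (k θ)))
      refine Finset.le_inf' _ _ fun j _ => ?_
      simp only [Equiv.symm_apply_apply]
      exact he2 θ _ x rfl
    · refine Finset.sup'_le _ _ fun i _ => ?_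
      refine le_trans (Finset.inf'_le _ (Finset.mem_univ (k θ))) ?_
      simp only [Equiv.symm_apply_apply]
      exact he1 _ θ x rfl
end

section
/- Let π₁,…,π_b ∈ ℝ[x₁,…,x_n] be nonconstant polynomials of degree one inducing a hyperplane partition of ℝⁿ, and let f : ℝⁿ → ℝ be a spline of degree d on this partition. Then there exist p ∈ ℕ and polynomials f_{ij} ∈ ℝ[x₁,…,x_n] (1 ≤ i, j ≤ p) with deg f_{ij} ≤ 2d + 1 such that f(x) = max_{i=1,…,p} min_{j=1,…,p} f_{ij}(x) for all x ∈ ℝⁿ. -/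
open MvPolynomial

/-- Degree one polynomials are affine. -/
lemma affine_eval {n : ℕ} (p : MvPolynomial (Fin n) ℝ) (hp : p.totalDegree ≤ 1)
    (x y z : Fin n → ℝ) (s : ℝ) :
    eval (x + s • (y - z)) p = eval x p + s * (eval y p - eval z p) := by
  simp only [eval_eq]
  rw [← Finset.sum_sub_distrib, Finset.mul_sum, ← Finset.sum_add_distrib]
  refine Finset.sum_congr rfl fun m hm => ?_
  have h1 : m.degree ≤ 1 := by
    have := le_totalDegree hm
    rw [Finsupp.degree_eq_sum]
    rw [Finsupp.sum_fintype _ _ (by simp)] at this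
    omega
  rcases Nat.lt_or_ge m.degree 1 with h | h
  · have : m = 0 := by
      have h0 : m.degree = 0 := by omega
      exact (Finsupp.degree_eq_zero_iff m).1 h0
    subst this
    simp
  · have h2 : m.degree = 1 := by omega
    obtain ⟨k, rfl⟩ := (Finsupp.sum_eq_one_iff m).1 h2
    rw [Finsupp.support_single_ne_zero _ one_ne_zero]
    simp
    ring

/-- A polynomial vanishing on a nonempty open set is zero. -/
lemma eq_zero_of_open {n : ℕ} (p : MvPolynomial (Fin n) ℝ) (U : Set (Fin n → ℝ))
    (hU : IsOpen U) (hne : U.Nonempty) (h : ∀ x ∈ U, eval x p = 0) : p = 0 := by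
  obtain ⟨x, hx⟩ := hne
  obtain ⟨ε, hε, hb⟩ := Metric.isOpen_iff.1 hU x hx
  refine MvPolynomial.funext_set (fun i => Metric.ball (x i) ε) (fun i => ?_) ?_
  · rw [Real.ball_eq_Ioo]
    exact Set.Ioo_infinite (by linarith)
  · intro y hy
    rw [map_zero]
    apply h _ (hb _)
    rw [ball_pi _ hε]
    exact hy

lemma isOpen_piece {n b : ℕ} (π : Fin b → MvPolynomial (Fin n) ℝ) (θ : Fin b → SignType)
    (h0 : ∀ i, θ i ≠ 0) : IsOpen (piece π θ) := by
  have : piece π θ = ⋂ i, {x | 0 < (θ i : ℝ) * eval x (π i)} := by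
    ext x
    simp only [piece, Set.mem_ofPred_eq, Set.mem_iInter]
    refine forall_congr' fun i => ?_
    have := h0 i
    generalize θ i = s at *
    cases s
    · simp at this
    · simp [sign_eq_neg_one_iff]
    · simp [sign_eq_one_iff]
  rw [this]
  exact isOpen_iInter_of_finite fun i =>
    isOpen_lt continuous_const (continuous_const.mul (MvPolynomial.continuous_eval _))

/-- Substitution divisibility: if `p` vanishes on a relatively open nonempty subset of the
hyperplane `l = 0`, then `l ∣ p`. -/
lemma dvd_of_vanish {n : ℕ} (l p : MvPolynomial (Fin n) ℝ) (hl : l.totalDegree ≤ 1)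
    (a b : Fin n → ℝ) (hab : eval a l - eval b l ≠ 0) (U : Set (Fin n → ℝ)) (hU : IsOpen U)
    (x0 : Fin n → ℝ) (hx0 : x0 ∈ U) (hx0l : eval x0 l = 0)
    (h : ∀ x ∈ U, eval x l = 0 → eval x p = 0) : l ∣ p := by
  set c := eval a l - eval b l with hc
  let σ : Fin n → MvPolynomial (Fin n) ℝ := fun k => X k - C ((a k - b k) / c) * l
  have hev : ∀ x, (fun k => eval x (σ k)) = x + (-(eval x l) / c) • (a - b) := by
    intro x
    ext k
    simp [σ]
    ring
  have h0 : aeval σ p = 0 := by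
    refine eq_zero_of_open _ ((fun x => fun k => eval x (σ k)) ⁻¹' U) (hU.preimage ?_)
      ⟨x0, ?_⟩ ?_
    · exact continuous_pi fun k => MvPolynomial.continuous_eval _
    · simp only [Set.mem_preimage, hev, hx0l]
      simpa using hx0
    · intro x hx
      have : eval x (aeval σ p) = eval (fun k => eval x (σ k)) p := by
        rw [aeval_def, eval₂_eq, map_sum, eval_eq]
        simp [map_prod]
      rw [this]
      refine h _ hx ?_
      rw [hev, affine_eval l hl, ← hc]
      field_simp
      ring
  have hq : (Ideal.Quotient.mkₐ ℝ (Ideal.span {l})).comp (aeval σ)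
      = Ideal.Quotient.mkₐ ℝ (Ideal.span {l}) := by
    ext k
    simp only [AlgHom.comp_apply, aeval_X, σ]
    simp only [Ideal.Quotient.mkₐ_eq_mk]
    rw [Ideal.Quotient.eq, Ideal.mem_span_singleton]
    exact ⟨-C ((a k - b k) / c), by ring⟩
  have := DFunLike.congr_fun hq p
  rw [AlgHom.comp_apply, h0, map_zero, eq_comm, Ideal.Quotient.mkₐ_eq_mk,
    Ideal.Quotient.eq_zero_iff_mem, Ideal.mem_span_singleton] at this
  exact this

lemma sign_combo {u v t : ℝ} {s : SignType} (hu : SignType.sign u = s) (hv : SignType.sign v = s)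
    (h0 : 0 ≤ t) (h1 : t ≤ 1) : SignType.sign (u + t * (v - u)) = s := by
  have e : u + t * (v - u) = (1 - t) * u + t * v := by ring
  rw [e]
  rcases h1.lt_or_eq with h1 | rfl
  swap
  · simpa using hv
  cases s
  · simp only [SignType.zero_eq_zero, sign_eq_zero_iff] at *
    simp [hu, hv]
  · simp only [SignType.neg_eq_neg_one, sign_eq_neg_one_iff] at *
    nlinarith [mul_pos_of_neg_of_neg (sub_neg.2 h1) hu]
  · simp only [SignType.pos_eq_one, sign_eq_one_iff] at *
    nlinarith [mul_pos (sub_pos.2 h1) hu]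

lemma opp_signs {θ θ' : SignType} (h : θ ≠ 0) (h' : θ' ≠ 0) (hne : θ ≠ θ') {u v : ℝ}
    (hu : SignType.sign u = θ) (hv : SignType.sign v = θ') : (0 < u ∧ v < 0) ∨ (u < 0 ∧ 0 < v) := by
  subst hu hv
  rw [sign_ne_zero] at h h'
  rcases lt_or_gt_of_ne h with h | h <;> rcases lt_or_gt_of_ne h' with h' | h'
  · simp [sign_neg h, sign_neg h'] at hne
  · exact Or.inr ⟨h, h'⟩
  · exact Or.inl ⟨h, h'⟩
  · simp [sign_pos h, sign_pos h'] at hne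

/-- Splitting step: an intermediate chamber. -/
lemma exists_mid_chamber {n b : ℕ} (π : Fin b → MvPolynomial (Fin n) ℝ)
    (hπ : ∀ i, (π i).totalDegree = 1) (θ θ' : Fin b → SignType)
    (hθ : ∀ i, θ i ≠ 0) (hθ' : ∀ i, θ' i ≠ 0)
    (x y : Fin n → ℝ) (hx : x ∈ piece π θ) (hy : y ∈ piece π θ') (i j : Fin b)
    (hi : θ i ≠ θ' i) (hj : θ j ≠ θ' j)
    (hij : eval x (π i) / (eval x (π i) - eval y (π i)) <
      eval x (π j) / (eval x (π j) - eval y (π j))) :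
    ∃ η : Fin b → SignType, (∀ k, η k ≠ 0) ∧ (piece π η).Nonempty ∧ η i = θ' i ∧ η j = θ j ∧
      ∀ k, θ k = θ' k → η k = θ k := by
  set ti := eval x (π i) / (eval x (π i) - eval y (π i)) with hti
  set tj := eval x (π j) / (eval x (π j) - eval y (π j)) with htj
  have hfin : (⋃ k, {t : ℝ | eval x (π k) + t * (eval y (π k) - eval x (π k)) = 0}).Finite := by
    refine Set.finite_iUnion fun k => Set.Subsingleton.finite ?_
    intro s hs t ht
    simp only [Set.mem_ofPred_eq] at hs ht
    have hk : eval x (π k) ≠ 0 := by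
      have := hθ k
      rw [← hx k] at this
      exact sign_ne_zero.1 this
    have hd : eval y (π k) - eval x (π k) ≠ 0 := by
      intro h
      rw [h] at hs
      simp [hk] at hs
    apply mul_right_cancel₀ hd
    linarith
  obtain ⟨t, ht, htn⟩ := ((Set.Ioo_infinite hij).diff hfin).nonempty
  simp only [Set.mem_iUnion, Set.mem_ofPred_eq, not_exists] at htn
  have hev : ∀ k, eval (x + t • (y - x)) (π k) = eval x (π k) + t * (eval y (π k) - eval x (π k)) :=
    fun k => affine_eval _ (hπ k).le _ _ _ _
  have si := opp_signs (hθ i) (hθ' i) hi (hx i) (hy i)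
  have sj := opp_signs (hθ j) (hθ' j) hj (hx j) (hy j)
  have hti0 : 0 < ti := by
    rcases si with h | h
    · exact div_pos h.1 (by linarith)
    · exact div_pos_of_neg_of_neg h.1 (by linarith)
  have htj1 : tj < 1 := by
    rcases sj with h | h
    · rw [htj, div_lt_one (by linarith)]; linarith
    · rw [htj, div_lt_one_of_neg (by linarith)]; linarith
  refine ⟨fun k => SignType.sign (eval (x + t • (y - x)) (π k)), fun k => ?_,
    ⟨x + t • (y - x), fun k => rfl⟩, ?_, ?_, ?_⟩
  · rw [sign_ne_zero, hev]
    exact htn k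
  · simp only [hev]
    rw [← hy i]
    have h1 := ht.1
    rw [hti] at h1
    rcases si with h | h
    · rw [div_lt_iff₀ (by linarith)] at h1
      rw [sign_neg h.2, sign_neg (by linarith)]
    · rw [div_lt_iff_of_neg (by linarith)] at h1
      rw [sign_pos h.2, sign_pos (by linarith)]
  · simp only [hev]
    rw [← hx j]
    have h1 := ht.2
    rw [htj] at h1
    rcases sj with h | h
    · rw [lt_div_iff₀ (by linarith)] at h1
      rw [sign_pos h.1, sign_pos (by linarith)]
    · rw [lt_div_iff_of_neg (by linarith)] at h1
      rw [sign_neg h.1, sign_neg (by linarith)]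
  · intro k hk
    simp only [hev]
    exact sign_combo (hx k) ((hy k).trans hk.symm) (by linarith [ht.1]) (by linarith [ht.2])

/-- Adjacent chambers: all separating forms are proportional. -/
lemma dvd_adjacent {n b : ℕ} (π : Fin b → MvPolynomial (Fin n) ℝ)
    (hπ : ∀ i, (π i).totalDegree = 1) (f : (Fin n → ℝ) → ℝ) (hf : Continuous f)
    (θ θ' : Fin b → SignType)
    (hθ : ∀ i, θ i ≠ 0) (hθ' : ∀ i, θ' i ≠ 0)
    (x y : Fin n → ℝ) (hx : x ∈ piece π θ) (hy : y ∈ piece π θ') (i : Fin b)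
    (hi : θ i ≠ θ' i)
    (hprop : ∀ j, θ j ≠ θ' j → C (eval y (π i)) * π j = C (eval y (π j)) * π i)
    (g g' : MvPolynomial (Fin n) ℝ) (hg : ∀ z ∈ piece π θ, f z = eval z g)
    (hg' : ∀ z ∈ piece π θ', f z = eval z g') : π i ∣ g - g' := by
  have si := opp_signs (hθ i) (hθ' i) hi (hx i) (hy i)
  have hc : eval x (π i) - eval y (π i) ≠ 0 := by
    rcases si with h | h
    · exact ne_of_gt (by linarith)
    · exact ne_of_lt (by linarith)
  set t := eval x (π i) / (eval x (π i) - eval y (π i)) with ht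
  have ht0 : 0 < t := by
    rcases si with h | h
    · exact div_pos h.1 (by linarith)
    · exact div_pos_of_neg_of_neg h.1 (by linarith)
  have ht1 : t < 1 := by
    rcases si with h | h
    · rw [ht, div_lt_one (by linarith)]; linarith
    · rw [ht, div_lt_one_of_neg (by linarith)]; linarith
  have hyi : eval y (π i) ≠ 0 := by
    rcases si with h | h
    · exact ne_of_lt h.2
    · exact ne_of_gt h.2
  have hxi : eval x (π i) ≠ 0 := by
    rcases si with h | h
    · exact ne_of_gt h.1
    · exact ne_of_lt h.1
  -- the signs of separating forms are determined by the sign of `π i`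
  have key : ∀ z w, eval w (π i) ≠ 0 → SignType.sign (eval z (π i)) = SignType.sign (eval w (π i)) →
      ∀ j, θ j ≠ θ' j → SignType.sign (eval z (π j)) = SignType.sign (eval w (π j)) := by
    intro z w hw hzw j hj
    have hp : ∀ z, eval z (π j) = (eval y (π j) / eval y (π i)) * eval z (π i) := by
      intro z
      have := congrArg (eval z) (hprop j hj)
      simp only [map_mul, eval_C] at this
      field_simp
      linarith
    rw [hp z, hp w, sign_mul, sign_mul, hzw]
  let U : Set (Fin n → ℝ) :=
    ⋂ j, {z | θ j = θ' j → 0 < (θ j : ℝ) * eval z (π j)}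
  have hUmem : ∀ z, z ∈ U ↔ ∀ j, θ j = θ' j → SignType.sign (eval z (π j)) = θ j := by
    intro z
    simp only [U, Set.mem_iInter, Set.mem_ofPred_eq]
    refine forall_congr' fun j => imp_congr_right fun _ => ?_
    have := hθ j
    generalize θ j = s at *
    cases s
    · simp at this
    · simp [sign_eq_neg_one_iff]
    · simp [sign_eq_one_iff]
  have hUo : IsOpen U := by
    refine isOpen_iInter_of_finite fun j => ?_
    by_cases h : θ j = θ' j
    · simp only [h, true_imp_iff]
      exact isOpen_lt continuous_const (continuous_const.mul (MvPolynomial.continuous_eval _))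
    · simp [h]
  refine dvd_of_vanish (π i) (g - g') (hπ i).le x y hc U hUo (x + t • (y - x)) ?_ ?_ ?_
  · rw [hUmem]
    intro j hj
    rw [affine_eval _ (hπ j).le]
    exact sign_combo (hx j) ((hy j).trans hj.symm) ht0.le ht1.le
  · rw [affine_eval _ (hπ i).le, ht]
    field_simp
    ring
  · intro z hz hzi
    have hline : ∀ s : ℝ, eval (z + s • (x - y)) (π i) = s * (eval x (π i) - eval y (π i)) := by
      intro s
      rw [affine_eval _ (hπ i).le, hzi, zero_add]
    have hcont : Continuous fun s : ℝ => z + s • (x - y) := by fun_prop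
    have hnhds : ∀ᶠ s in nhds (0 : ℝ), z + s • (x - y) ∈ U := by
      apply hcont.continuousAt.eventually
      simpa using hUo.mem_nhds hz
    have h1 : f z = eval z g := by
      have e1 : Filter.Tendsto (fun s : ℝ => f (z + s • (x - y))) (nhdsWithin 0 (Set.Ioi 0))
          (nhds (f z)) := by
        have := (hf.comp hcont).tendsto 0
        simp only [Function.comp_apply, zero_smul, add_zero] at this
        exact this.mono_left nhdsWithin_le_nhds
      have e2 : Filter.Tendsto (fun s : ℝ => eval (z + s • (x - y)) g) (nhdsWithin 0 (Set.Ioi 0))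
          (nhds (eval z g)) := by
        have := ((MvPolynomial.continuous_eval g).comp hcont).tendsto 0
        simp only [Function.comp_apply, zero_smul, add_zero] at this
        exact this.mono_left nhdsWithin_le_nhds
      refine tendsto_nhds_unique_of_eventuallyEq e1 e2 ?_
      filter_upwards [nhdsWithin_le_nhds hnhds, self_mem_nhdsWithin] with s hs hs0
      have hs0 : 0 < s := hs0
      refine hg _ fun j => ?_
      by_cases h : θ j = θ' j
      · exact (hUmem _).1 hs j h
      · rw [← hx j]
        refine key _ _ hxi ?_ j h
        rw [hline, sign_mul, sign_pos hs0, one_mul]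
        rcases si with h | h
        · rw [sign_pos h.1, sign_pos (by linarith)]
        · rw [sign_neg h.1, sign_neg (by linarith)]
    have h2 : f z = eval z g' := by
      have e1 : Filter.Tendsto (fun s : ℝ => f (z + s • (x - y))) (nhdsWithin 0 (Set.Iio 0))
          (nhds (f z)) := by
        have := (hf.comp hcont).tendsto 0
        simp only [Function.comp_apply, zero_smul, add_zero] at this
        exact this.mono_left nhdsWithin_le_nhds
      have e2 : Filter.Tendsto (fun s : ℝ => eval (z + s • (x - y)) g') (nhdsWithin 0 (Set.Iio 0))
          (nhds (eval z g')) := by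
        have := ((MvPolynomial.continuous_eval g').comp hcont).tendsto 0
        simp only [Function.comp_apply, zero_smul, add_zero] at this
        exact this.mono_left nhdsWithin_le_nhds
      refine tendsto_nhds_unique_of_eventuallyEq e1 e2 ?_
      filter_upwards [nhdsWithin_le_nhds hnhds, self_mem_nhdsWithin] with s hs hs0
      have hs0 : s < 0 := hs0
      refine hg' _ fun j => ?_
      by_cases h : θ j = θ' j
      · rw [← h]
        exact (hUmem _).1 hs j h
      · rw [← hy j]
        refine key _ _ hyi ?_ j h
        rw [hline]
        rcases si with h | h
        · rw [sign_neg h.2, sign_neg (mul_neg_of_neg_of_pos hs0 (by linarith))]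
        · rw [sign_pos h.2, sign_pos (mul_pos_of_neg_of_neg hs0 (by linarith))]
    rw [map_sub, ← h1, ← h2, sub_self]

/-- Difference of two chamber polynomials as a combination of separating forms. -/
lemma exists_decomp {n b d : ℕ} (π : Fin b → MvPolynomial (Fin n) ℝ)
    (hπ : ∀ i, (π i).totalDegree = 1) (f : (Fin n → ℝ) → ℝ) (hf : Continuous f)
    (g : (Fin b → SignType) → MvPolynomial (Fin n) ℝ) (hgd : ∀ θ, (g θ).totalDegree ≤ d)
    (hg : ∀ θ, ∀ z ∈ piece π θ, f z = eval z (g θ)) :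
    ∀ (N : ℕ) (θ θ' : Fin b → SignType), (∀ i, θ i ≠ 0) → (∀ i, θ' i ≠ 0) →
      (piece π θ).Nonempty → (piece π θ').Nonempty →
      (Finset.univ.filter fun i => θ i ≠ θ' i).card ≤ N →
      ∃ q : Fin b → MvPolynomial (Fin n) ℝ, (∀ i, (q i).totalDegree ≤ d) ∧
        (∀ i, θ i = θ' i → q i = 0) ∧ g θ - g θ' = ∑ i, π i * q i := by
  intro N
  induction N with
  | zero =>
    intro θ θ' _ _ _ _ hN
    have : θ = θ' := by
      ext i
      by_contra h
      have hmem : i ∈ Finset.univ.filter fun i => θ i ≠ θ' i := by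
        simp only [Finset.mem_filter, Finset.mem_univ, true_and]
        intro h'
        exact h (by rw [h'])
      have := Finset.card_pos.2 ⟨i, hmem⟩
      omega
    subst this
    exact ⟨0, by simp, by simp, by simp⟩
  | succ N ih =>
    intro θ θ' hθ hθ' hne hne' hN
    have split : ∀ η : Fin b → SignType, (∀ k, η k ≠ 0) → (piece π η).Nonempty →
        ∀ i j, θ i ≠ θ' i → θ j ≠ θ' j → η i = θ' i → η j = θ j →
        (∀ k, θ k = θ' k → η k = θ k) →
        ∃ q : Fin b → MvPolynomial (Fin n) ℝ, (∀ i, (q i).totalDegree ≤ d) ∧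
        (∀ i, θ i = θ' i → q i = 0) ∧ g θ - g θ' = ∑ i, π i * q i := by
      intro η hη hηne i j hi hj hηi hηj hηk
      have c1 : (Finset.univ.filter fun i => θ i ≠ η i).card <
          (Finset.univ.filter fun i => θ i ≠ θ' i).card := by
        apply Finset.card_lt_card
        rw [Finset.ssubset_iff_of_subset]
        · exact ⟨j, by simp [hj], by simp [hηj]⟩
        · intro k
          simp only [Finset.mem_filter, Finset.mem_univ, true_and]
          exact fun h h' => h (hηk k h').symm
      have c2 : (Finset.univ.filter fun i => η i ≠ θ' i).card <
          (Finset.univ.filter fun i => θ i ≠ θ' i).card := by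
        apply Finset.card_lt_card
        rw [Finset.ssubset_iff_of_subset]
        · exact ⟨i, by simp [hi], by simp [hηi]⟩
        · intro k
          simp only [Finset.mem_filter, Finset.mem_univ, true_and]
          exact fun h h' => h ((hηk k h').trans h')
      obtain ⟨q1, hq1, hq1', e1⟩ := ih θ η hθ hη hne hηne (by omega)
      obtain ⟨q2, hq2, hq2', e2⟩ := ih η θ' hη hθ' hηne hne' (by omega)
      refine ⟨fun k => q1 k + q2 k, fun k => ?_, fun k hk => ?_, ?_⟩
      · exact (totalDegree_add _ _).trans (max_le (hq1 k) (hq2 k))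
      · show q1 k + q2 k = 0
        rw [hq1' k (hηk k hk).symm, hq2' k ((hηk k hk).trans hk), add_zero]
      · simp only [mul_add, Finset.sum_add_distrib]
        rw [← e1, ← e2]
        ring
    obtain ⟨y, hy⟩ := hne'
    by_cases hD : ∃ i, θ i ≠ θ' i
    swap
    · push Not at hD
      have : θ = θ' := _root_.funext hD
      subst this
      exact ⟨0, by simp, by simp, by simp⟩
    obtain ⟨i, hi⟩ := hD
    by_cases hcase : ∃ x ∈ piece π θ, ∃ j, θ j ≠ θ' j ∧
        eval x (π i) / (eval x (π i) - eval y (π i)) ≠ eval x (π j) / (eval x (π j) - eval y (π j))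
    · obtain ⟨x, hx, j, hj, hij⟩ := hcase
      rcases lt_or_gt_of_ne hij with h | h
      · obtain ⟨η, h1, h2, h3, h4, h5⟩ :=
          exists_mid_chamber π hπ θ θ' hθ hθ' x y hx hy i j hi hj h
        exact split η h1 h2 i j hi hj h3 h4 h5
      · obtain ⟨η, h1, h2, h3, h4, h5⟩ :=
          exists_mid_chamber π hπ θ θ' hθ hθ' x y hx hy j i hj hi h
        exact split η h1 h2 j i hj hi h3 h4 h5
    · push Not at hcase
      have hprop : ∀ j, θ j ≠ θ' j → C (eval y (π i)) * π j = C (eval y (π j)) * π i := by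
        intro j hj
        rw [← sub_eq_zero]
        refine eq_zero_of_open _ (piece π θ) (isOpen_piece π θ hθ) hne fun x hx => ?_
        have h := hcase x hx j hj
        have si := opp_signs (hθ i) (hθ' i) hi (hx i) (hy i)
        have sj := opp_signs (hθ j) (hθ' j) hj (hx j) (hy j)
        have di : eval x (π i) - eval y (π i) ≠ 0 := by
          rcases si with h | h
          · exact ne_of_gt (by linarith)
          · exact ne_of_lt (by linarith)
        have dj : eval x (π j) - eval y (π j) ≠ 0 := by
          rcases sj with h | h
          · exact ne_of_gt (by linarith)
          · exact ne_of_lt (by linarith)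
        rw [div_eq_div_iff di dj] at h
        simp only [map_sub, map_mul, eval_C]
        linarith
      obtain ⟨x, hx⟩ := hne
      obtain ⟨q, hq⟩ := dvd_adjacent π hπ f hf θ θ' hθ hθ' x y hx hy i hi hprop (g θ) (g θ')
        (hg θ) (hg θ')
      have hqd : q.totalDegree ≤ d := by
        by_cases hq0 : q = 0
        · simp [hq0]
        · have hp0 : π i ≠ 0 := by
            intro h
            have := hπ i
            simp [h] at this
          have h1 := totalDegree_mul_of_isDomain hp0 hq0
          have h2 := totalDegree_sub (g θ) (g θ')
          rw [hq, h1] at h2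
          have := max_le (hgd θ) (hgd θ')
          omega
      refine ⟨Pi.single i q, fun k => ?_, fun k hk => ?_, ?_⟩
      · by_cases h : k = i
        · subst h; simpa using hqd
        · simp [h]
      · have : k ≠ i := by
          rintro rfl
          exact hi hk
        simp [this]
      · rw [hq, Finset.sum_eq_single i]
        · simp
        · intro k _ hk
          simp [hk]
        · simp

/-- Interpolating polynomial for a pair of chambers. -/
lemma exists_interp {n b d : ℕ} (π : Fin b → MvPolynomial (Fin n) ℝ)
    (hπ : ∀ i, (π i).totalDegree = 1) (f : (Fin n → ℝ) → ℝ) (hf : Continuous f)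
    (g : (Fin b → SignType) → MvPolynomial (Fin n) ℝ) (hgd : ∀ θ, (g θ).totalDegree ≤ d)
    (hg : ∀ θ, ∀ z ∈ piece π θ, f z = eval z (g θ))
    (θ θ' : Fin b → SignType) (hθ : ∀ i, θ i ≠ 0) (hθ' : ∀ i, θ' i ≠ 0)
    (hne : (piece π θ).Nonempty) (hne' : (piece π θ').Nonempty) :
    ∃ h : MvPolynomial (Fin n) ℝ, h.totalDegree ≤ 2 * d + 1 ∧
      (∀ x ∈ piece π θ, eval x h ≤ f x) ∧ (∀ x ∈ piece π θ', f x ≤ eval x h) ∧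
      (θ = θ' → ∀ x ∈ piece π θ', eval x h = f x) := by
  obtain ⟨q, hqd, hq0, hq⟩ := exists_decomp π hπ f hf g hgd hg _ θ θ' hθ hθ' hne hne' le_rfl
  refine ⟨g θ' + ∑ i, if θ i = θ' i then 0 else -C (θ i : ℝ) * π i * (1 + q i ^ 2),
    ?_, ?_, ?_, ?_⟩
  · refine (totalDegree_add _ _).trans (max_le ((hgd _).trans (by omega)) ?_)
    refine totalDegree_finsetSum_le fun i _ => ?_
    split_ifs
    · simp
    · refine (totalDegree_mul _ _).trans ?_
      have h1 : (-C (θ i : ℝ) * π i).totalDegree ≤ 1 := by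
        refine (totalDegree_mul _ _).trans ?_
        rw [totalDegree_neg, totalDegree_C, hπ i]
      have h2 : (1 + q i ^ 2).totalDegree ≤ 2 * d := by
        refine (totalDegree_add _ _).trans (max_le (by simp) ?_)
        refine (totalDegree_pow _ _).trans ?_
        have := hqd i
        omega
      omega
  · intro x hx
    rw [hg θ x hx, eq_add_of_sub_eq' hq, map_add, map_add, map_sum, map_sum]
    gcongr with i
    split_ifs with h
    · simp [hq0 i h]
    · simp only [map_mul, map_neg, eval_C, map_add, map_one, map_pow]
      have e : (θ i : ℝ) * eval x (π i) = |eval x (π i)| := by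
        rw [← hx i, sign_mul_self]
      rw [neg_mul, e]
      have h1 := abs_nonneg (eval x (π i))
      have h2 : -(|eval x (π i)| * |eval x (q i)|) ≤ eval x (π i) * eval x (q i) := by
        rw [← abs_mul]
        exact neg_abs_le _
      have h3 : |eval x (q i)| ≤ 1 + eval x (q i) ^ 2 := by
        rw [← sq_abs]
        nlinarith [sq_nonneg (|eval x (q i)| - 1), abs_nonneg (eval x (q i))]
      nlinarith [mul_le_mul_of_nonneg_left h3 h1]
  · intro x hx
    rw [hg θ' x hx, map_add, map_sum]
    refine le_add_of_nonneg_right (Finset.sum_nonneg fun i _ => ?_)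
    split_ifs with h
    · simp
    · simp only [map_mul, map_neg, eval_C, map_add, map_one, map_pow]
      obtain ⟨w, hw⟩ := hne
      have e : (θ i : ℝ) * eval x (π i) ≤ 0 := by
        rcases opp_signs (hθ i) (hθ' i) h (hw i) (hx i) with hh | hh
        · rw [← hw i, sign_pos hh.1]
          simpa using hh.2.le
        · rw [← hw i, sign_neg hh.1]
          simpa using hh.2.le
      have : 0 ≤ 1 + eval x (q i) ^ 2 := by positivity
      nlinarith
  · rintro rfl x hx
    rw [hg θ x hx]
    simp

/-- Every spline of degree `d` on a hyperplane partition is a max-min of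
finitely many polynomials of degree at most `2d + 1`. -/
theorem pierce_birkhoff_for_splines_degree_bound {n b d : ℕ}
    (π : Fin b → MvPolynomial (Fin n) ℝ) (hπ : ∀ i, (π i).totalDegree = 1)
    (f : (Fin n → ℝ) → ℝ) (hf : IsSpline π d f) :
    ∃ (p : ℕ) (F : Fin (p + 1) → Fin (p + 1) → MvPolynomial (Fin n) ℝ),
      (∀ i j, (F i j).totalDegree ≤ 2 * d + 1) ∧
      ∀ x : Fin n → ℝ,
        f x = Finset.univ.sup' Finset.univ_nonempty (fun i =>
          Finset.univ.inf' Finset.univ_nonempty (fun j => eval x (F i j))) := by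
  classical
  obtain ⟨hfc, hfp⟩ := hf
  have hex : ∀ θ : Fin b → SignType, ∃ g : MvPolynomial (Fin n) ℝ,
      g.totalDegree ≤ d ∧ ∀ x ∈ piece π θ, f x = eval x g := by
    intro θ
    by_cases h : (piece π θ).Nonempty
    · exact hfp θ h
    · exact ⟨0, by simp, fun x hx => absurd ⟨x, hx⟩ h⟩
  choose g hgd hg using hex
  -- the union of open chambers is dense
  have hdense : Dense {x : Fin n → ℝ | ∀ i, eval x (π i) ≠ 0} := by
    rw [dense_iff_inter_open]
    intro U hU hUne
    by_contra hcon
    have hP : (∏ i, π i) = 0 := by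
      refine eq_zero_of_open _ U hU hUne fun x hx => ?_
      by_contra h
      refine hcon ⟨x, hx, fun i hi => h ?_⟩
      rw [map_prod]
      exact Finset.prod_eq_zero (Finset.mem_univ i) hi
    obtain ⟨i, -, hi⟩ := Finset.prod_eq_zero_iff.1 hP
    have := hπ i
    simp [hi] at this
  let I := {θ : Fin b → SignType // (∀ i, θ i ≠ 0) ∧ (piece π θ).Nonempty}
  have hI : ∀ x : Fin n → ℝ, (∀ i, eval x (π i) ≠ 0) → ∃ θ : I, x ∈ piece π θ.1 := by
    intro x hx
    exact ⟨⟨fun i => SignType.sign (eval x (π i)), fun i => sign_ne_zero.2 (hx i),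
      ⟨x, fun i => rfl⟩⟩, fun i => rfl⟩
  have hIne : Nonempty I := by
    obtain ⟨x, hx⟩ := hdense.nonempty
    exact ⟨(hI x hx).choose⟩
  have hint : ∀ A B : I, _ := fun A B =>
    exists_interp π hπ f hfc g hgd hg A.1 B.1 A.2.1 B.2.1 A.2.2 B.2.2
  choose h hd hle hge heq using hint
  obtain ⟨p, hp⟩ : ∃ p, Fintype.card I = p + 1 :=
    Nat.exists_eq_succ_of_ne_zero Fintype.card_ne_zero
  let e : Fin (p + 1) ≃ I := (Fintype.equivFinOfCardEq hp).symm
  refine ⟨p, fun i j => h (e j) (e i), fun i j => hd _ _, fun x => ?_⟩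
  refine congrFun (g := fun x => Finset.univ.sup' Finset.univ_nonempty (fun i =>
    Finset.univ.inf' Finset.univ_nonempty (fun j => eval x (h (e j) (e i)))))
    (Continuous.ext_on hdense hfc ?_ ?_) x
  · refine Continuous.finset_sup'_apply _ fun i _ => Continuous.finset_inf'_apply _ fun j _ => ?_
    exact MvPolynomial.continuous_eval _
  · intro x hx
    obtain ⟨A, hA⟩ := hI x hx
    apply le_antisymm
    · refine le_trans ?_ (Finset.le_sup' _ (Finset.mem_univ (e.symm A)))
      refine Finset.le_inf' _ _ fun j _ => ?_
      simpa using hge (e j) A x hA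
    · refine Finset.sup'_le _ _ fun i _ => ?_
      refine (Finset.inf'_le _ (Finset.mem_univ (e.symm A))).trans ?_
      simpa using hle A (e i) x hA
end

section
/- Let V₁,…,V_p ⊆ ℝⁿ be sets with V₁ ∪ ⋯ ∪ V_p = ℝⁿ, let f : ℝⁿ → ℝ, and let g₁,…,g_p ∈ ℝ[x₁,…,x_n] be polynomials such that f(x) = g_i(x) for all x ∈ V_i, i = 1,…,p. Suppose that for all i, j ∈ {1,…,p} there exists h_{ij} ∈ ℝ[x₁,…,x_n] such that h_{ij}(x) ≤ g_j(x) − g_i(x) for all x ∈ V_j and h_{ij}(x) ≥ 0 for all x ∈ V_i. Then, setting f_{ij} := h_{ij} + g_i, one has f(x) = max_{i=1,…,p} min_{j=1,…,p} f_{ij}(x) for all x ∈ ℝⁿ; in particular deg f_{ij} ≤ max{deg g_i, deg h_{ij} : i, j = 1,…,p}. -/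
open MvPolynomial

/-- If `ℝⁿ = V₁ ∪ ⋯ ∪ V_p`, `f` agrees with the polynomial `gᵢ` on `Vᵢ`, and for
all `i, j` there is a polynomial `hᵢⱼ` with `hᵢⱼ ≤ gⱼ − gᵢ` on `Vⱼ` and `hᵢⱼ ≥ 0`
on `Vᵢ`, then setting `fᵢⱼ := hᵢⱼ + gᵢ` one has `f = maxᵢ minⱼ fᵢⱼ`; in
particular `deg fᵢⱼ ≤ max {deg gᵢ, deg hᵢⱼ}`. -/
theorem maxmin_of_separating_polynomials {n p : ℕ}
    (V : Fin (p + 1) → Set (Fin n → ℝ))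
    (hV : (⋃ i, V i) = Set.univ)
    (f : (Fin n → ℝ) → ℝ)
    (g : Fin (p + 1) → MvPolynomial (Fin n) ℝ)
    (hfg : ∀ i, ∀ x ∈ V i, f x = eval x (g i))
    (h : Fin (p + 1) → Fin (p + 1) → MvPolynomial (Fin n) ℝ)
    (hh₁ : ∀ i j, ∀ x ∈ V j, eval x (h i j) ≤ eval x (g j) - eval x (g i))
    (hh₂ : ∀ i j, ∀ x ∈ V i, 0 ≤ eval x (h i j)) :
    (∀ x : Fin n → ℝ,
      f x = Finset.univ.sup' Finset.univ_nonempty (fun i =>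
        Finset.univ.inf' Finset.univ_nonempty
          (fun j => eval x (h i j + g i)))) ∧
    (∀ i j, (h i j + g i).totalDegree ≤
      max (Finset.univ.sup fun k => (g k).totalDegree)
        (Finset.univ.sup fun q : Fin (p + 1) × Fin (p + 1) =>
          (h q.1 q.2).totalDegree)) := by
  refine ⟨fun x => ?_, fun i j => ?_⟩
  · have hx : x ∈ ⋃ i, V i := by rw [hV]; trivial
    obtain ⟨k, hk⟩ := Set.mem_iUnion.1 hx
    rw [hfg k x hk]
    apply le_antisymm
    · refine le_trans ?_ (Finset.le_sup' _ (Finset.mem_univ k))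
      refine Finset.le_inf' _ _ fun j _ => ?_
      rw [map_add]
      linarith [hh₂ k j x hk]
    · refine Finset.sup'_le _ _ fun i _ => ?_
      refine le_trans (Finset.inf'_le _ (Finset.mem_univ k)) ?_
      rw [map_add]
      linarith [hh₁ i k x hk]
  · refine le_trans (MvPolynomial.totalDegree_add _ _) (max_le ?_ ?_)
    · exact le_trans (Finset.le_sup (f := fun q : Fin (p + 1) × Fin (p + 1) =>
          (h q.1 q.2).totalDegree) (Finset.mem_univ (i, j))) (le_max_right _ _)
    · exact le_trans (Finset.le_sup (f := fun k => (g k).totalDegree)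
          (Finset.mem_univ i)) (le_max_left _ _)
end

section
/- Let π₁,…,π_b ∈ ℝ[x₁,…,x_n] be nonconstant polynomials of degree one inducing a hyperplane partition of ℝⁿ, let Π and Π' be two distinct chambers of this partition, and let V and W be the Euclidean closures of Π and Π' respectively. If V ∩ W ≠ ∅, then the separating ideal ⟨V, W⟩ equals the vanishing ideal of the affine span of V ∩ W, i.e., ⟨V, W⟩ = { g ∈ ℝ[x₁,…,x_n] : g(x) = 0 for all x in the affine span of V ∩ W }. -/
open MvPolynomial

/-- The separating ideal `⟨U, V⟩` of two subsets of `ℝⁿ`: the ideal generated by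
all polynomials that are nonnegative on `U` and nonpositive on `V`. -/
noncomputable def sepIdeal {n : ℕ} (U V : Set (Fin n → ℝ)) : Ideal (MvPolynomial (Fin n) ℝ) :=
  Ideal.span {h | (∀ x ∈ U, 0 ≤ eval x h) ∧ ∀ x ∈ V, eval x h ≤ 0}


lemma exists_affine_form {n : ℕ} (p : MvPolynomial (Fin n) ℝ) (hp : p.totalDegree ≤ 1) :
    ∃ (c : ℝ) (L : (Fin n → ℝ) →ₗ[ℝ] ℝ), ∀ x, eval x p = c + L x := by
  let S : Submodule ℝ ((Fin n → ℝ) → ℝ) :=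
    { carrier := {f | ∃ (c : ℝ) (L : (Fin n → ℝ) →ₗ[ℝ] ℝ), ∀ x, f x = c + L x}
      add_mem' := by
        rintro f g ⟨c, L, h⟩ ⟨c', L', h'⟩
        refine ⟨c + c', L + L', fun x => ?_⟩
        simp [h, h']; ring
      zero_mem' := ⟨0, 0, fun x => by simp⟩
      smul_mem' := by
        rintro a f ⟨c, L, h⟩
        refine ⟨a * c, a • L, fun x => ?_⟩
        simp [h]; ring }
  have key : (∑ d ∈ p.support, fun x : Fin n → ℝ => eval x (monomial d (coeff d p))) ∈ S := by
    refine Submodule.sum_mem _ fun d hd => ?_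
    have h1 := (le_totalDegree hd).trans hp
    rcases Nat.le_one_iff_eq_zero_or_eq_one.1 h1 with h | h
    · have h : d = 0 := by
        ext i
        by_contra hi
        have := (Finset.sum_eq_zero_iff.1 h) i (by simpa using hi)
        exact hi this
      subst h
      exact ⟨coeff 0 p, 0, fun x => by simp⟩
    · obtain ⟨k, rfl⟩ : ∃ k, d = Finsupp.single k 1 := by
        obtain ⟨k, hk⟩ := (Finsupp.sum_eq_one_iff d).1 h
        exact ⟨k, hk⟩
      exact ⟨0, (coeff (Finsupp.single k 1) p) • LinearMap.proj k, fun x => by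
        simp [eval_monomial]⟩
  obtain ⟨c, L, h⟩ := key
  refine ⟨c, L, fun x => ?_⟩
  rw [← h x]
  have h2 := congrArg (eval x) p.as_sum
  rw [map_sum] at h2
  rw [Finset.sum_apply]
  exact h2

lemma strict_sep {ι : Type*} [Fintype ι] (R : Submodule ℝ (ι → ℝ)) (s s' : ι → ℝ)
    (hs : ∀ i, s i = 1 ∨ s i = -1) (hs' : ∀ i, s' i = 1 ∨ s' i = -1)
    (h : ∀ y ∈ R, (∀ i, 0 ≤ s i * y i) → (∀ i, 0 ≤ s' i * y i) → y = 0) :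
    ∃ (f : (ι → ℝ) →ₗ[ℝ] ℝ) (ε : ℝ), 0 < ε ∧
      (∀ y ∈ R, (∀ i, 0 ≤ s i * y i) → ε * ∑ i, s i * y i ≤ f y) ∧
      (∀ y ∈ R, (∀ i, 0 ≤ s' i * y i) → f y ≤ - (ε * ∑ i, s' i * y i)) := by
  classical
  let P : Set ((ι → ℝ) × (ι → ℝ)) := {z | z.1 ∈ R ∧ z.2 ∈ R ∧ (∀ i, 0 ≤ s i * z.1 i) ∧
    (∀ i, 0 ≤ s' i * z.2 i) ∧ ∑ i, s i * z.1 i + ∑ i, s' i * z.2 i = 1}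
  have hRc : IsClosed (R : Set (ι → ℝ)) := R.closed_of_finiteDimensional
  have hPc : IsClosed P := by
    refine IsClosed.inter (hRc.preimage continuous_fst) (IsClosed.inter
      (hRc.preimage continuous_snd) (IsClosed.inter ?_ (IsClosed.inter ?_ ?_)))
    · have : {z : (ι → ℝ) × (ι → ℝ) | ∀ i, 0 ≤ s i * z.1 i} = ⋂ i, {z | 0 ≤ s i * z.1 i} := by
        ext; simp
      change IsClosed {z : (ι → ℝ) × (ι → ℝ) | ∀ i, 0 ≤ s i * z.1 i}
      exact this ▸ isClosed_iInter fun i => isClosed_le (by fun_prop) (by fun_prop)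
    · have : {z : (ι → ℝ) × (ι → ℝ) | ∀ i, 0 ≤ s' i * z.2 i} = ⋂ i, {z | 0 ≤ s' i * z.2 i} := by
        ext; simp
      change IsClosed {z : (ι → ℝ) × (ι → ℝ) | ∀ i, 0 ≤ s' i * z.2 i}
      exact this ▸ isClosed_iInter fun i => isClosed_le (by fun_prop) (by fun_prop)
    · exact isClosed_eq (by fun_prop) (by fun_prop)
  have hPk : IsCompact P := by
    refine IsCompact.of_isClosed_subset
      (isCompact_Icc (a := ((fun _ => -1, fun _ => -1) : (ι → ℝ) × (ι → ℝ)))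
        (b := (fun _ => 1, fun _ => 1))) hPc ?_
    rintro ⟨v, w⟩ ⟨-, -, hv, hw, hsum⟩
    have n1 := Finset.sum_nonneg fun i (_ : i ∈ Finset.univ) => hv i
    have n2 := Finset.sum_nonneg fun i (_ : i ∈ Finset.univ) => hw i
    have b1 : ∀ i, s i * v i ≤ 1 := fun i => by
      have := Finset.single_le_sum (fun i (_ : i ∈ Finset.univ) => hv i) (Finset.mem_univ i)
      simp only at *
      linarith
    have b2 : ∀ i, s' i * w i ≤ 1 := fun i => by
      have := Finset.single_le_sum (fun i (_ : i ∈ Finset.univ) => hw i) (Finset.mem_univ i)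
      simp only at *
      linarith
    refine ⟨⟨fun i => ?_, fun i => ?_⟩, ⟨fun i => ?_, fun i => ?_⟩⟩
    all_goals
      have h1 := b1 i
      have h2 := b2 i
      have h3 := hv i
      have h4 := hw i
      rcases hs i with e | e <;> rcases hs' i with e' | e' <;> simp only [e, e'] at h1 h2 h3 h4 ⊢ <;>
      linarith
  let φ : ((ι → ℝ) × (ι → ℝ)) →ₗ[ℝ] (ι → ℝ) := LinearMap.fst ℝ _ _ - LinearMap.snd ℝ _ _
  have hφ : Continuous φ := φ.continuous_of_finiteDimensional
  have hPconv : Convex ℝ P := by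
    rintro ⟨v, w⟩ ⟨hv1, hw1, hv, hw, hsum⟩ ⟨v', w'⟩ ⟨hv1', hw1', hv', hw', hsum'⟩ a b ha hb hab
    refine ⟨R.add_mem (R.smul_mem _ hv1) (R.smul_mem _ hv1'),
      R.add_mem (R.smul_mem _ hw1) (R.smul_mem _ hw1'), fun i => ?_, fun i => ?_, ?_⟩
    · have := add_nonneg (mul_nonneg ha (hv i)) (mul_nonneg hb (hv' i))
      simp at this ⊢; linarith
    · have := add_nonneg (mul_nonneg ha (hw i)) (mul_nonneg hb (hw' i))
      simp at this ⊢; linarith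
    · calc _ = a * (∑ i, s i * v i + ∑ i, s' i * w i)
            + b * (∑ i, s i * v' i + ∑ i, s' i * w' i) := by
            simp only [mul_add, Finset.mul_sum, ← Finset.sum_add_distrib]
            refine Finset.sum_congr rfl fun i _ => ?_
            simp; ring
        _ = 1 := by
            simp only at hsum hsum'
            rw [hsum, hsum']; linarith
  have h0 : (0 : ι → ℝ) ∉ φ '' P := by
    rintro ⟨⟨v, w⟩, ⟨hv1, hw1, hv, hw, hsum⟩, hz⟩
    have hvw : v = w := sub_eq_zero.1 hz
    subst hvw
    have := h v hv1 hv hw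
    subst this
    simp at hsum
  obtain ⟨f, u, hu, hf⟩ := geometric_hahn_banach_point_closed (hPconv.linear_image φ)
    (hPk.image hφ).isClosed h0
  rw [map_zero] at hu
  refine ⟨f.toLinearMap, u, hu, fun y hy hy0 => ?_, fun y hy hy0 => ?_⟩
  · have n1 := Finset.sum_nonneg fun i (_ : i ∈ Finset.univ) => hy0 i
    rcases n1.eq_or_lt with e | e
    · have : y = 0 := by
        ext i
        have := (Finset.sum_eq_zero_iff_of_nonneg fun i _ => hy0 i).1 e.symm i (Finset.mem_univ i)
        rcases hs i with e | e <;> simpa [e] using this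
      simp [this]
    · set S := ∑ i, s i * y i with hS
      have := hf _ ⟨(S⁻¹ • y, 0), ⟨R.smul_mem _ hy, R.zero_mem, fun i => ?_, fun i => by simp, ?_⟩, rfl⟩
      · have h2 : u < S⁻¹ * f y := by simpa [φ] using this
        have h3 := mul_lt_mul_of_pos_left h2 e
        rw [mul_inv_cancel_left₀ e.ne'] at h3
        simp; linarith
      · have := mul_nonneg (inv_nonneg.2 e.le) (hy0 i)
        simp; linarith
      · have : ∑ i, s i * (S⁻¹ * y i) = S⁻¹ * S := by
          rw [hS, Finset.mul_sum]; exact Finset.sum_congr rfl fun i _ => by ring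
        simp [this, e.ne']
  · have n1 := Finset.sum_nonneg fun i (_ : i ∈ Finset.univ) => hy0 i
    rcases n1.eq_or_lt with e | e
    · have : y = 0 := by
        ext i
        have := (Finset.sum_eq_zero_iff_of_nonneg fun i _ => hy0 i).1 e.symm i (Finset.mem_univ i)
        rcases hs' i with e | e <;> simpa [e] using this
      simp [this]
    · set S := ∑ i, s' i * y i with hS
      have := hf _ ⟨(0, S⁻¹ • y), ⟨R.zero_mem, R.smul_mem _ hy, fun i => by simp, fun i => ?_, ?_⟩, rfl⟩
      · have h2 : u < - (S⁻¹ * f y) := by simpa [φ] using this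
        have h3 := mul_lt_mul_of_pos_left h2 e
        rw [mul_neg, mul_inv_cancel_left₀ e.ne'] at h3
        simp; linarith
      · have := mul_nonneg (inv_nonneg.2 e.le) (hy0 i)
        simp; linarith
      · have : ∑ i, s' i * (S⁻¹ * y i) = S⁻¹ * S := by
          rw [hS, Finset.mul_sum]; exact Finset.sum_congr rfl fun i _ => by ring
        simp [this, e.ne']

/-- A polynomial vanishing on a nonempty affine subspace lies in the ideal of its equations. -/
lemma mem_span_of_vanish {n : ℕ} {ι : Type*} [Finite ι] (q : ι → MvPolynomial (Fin n) ℝ)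
    (L : ι → (Fin n → ℝ) →ₗ[ℝ] ℝ) (p : Fin n → ℝ) (hq : ∀ i x, eval x (q i) = L i (x - p))
    (g : MvPolynomial (Fin n) ℝ) (hg : ∀ x, (∀ i, eval x (q i) = 0) → eval x g = 0) :
    g ∈ Ideal.span (Set.range q) := by
  classical
  have := Fintype.ofFinite ι
  let E : Submodule ℝ (Fin n → ℝ) := ⨅ i, LinearMap.ker (L i)
  obtain ⟨T, hT⟩ := E.subtype.exists_leftInverse_of_injective (by simp)
  let Q : (Fin n → ℝ) →ₗ[ℝ] (Fin n → ℝ) := LinearMap.id - E.subtype ∘ₗ T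
  have hQ : ∀ k, ∃ c : ι → ℝ, ∑ i, c i • L i = LinearMap.proj k ∘ₗ Q := by
    intro k
    rw [← Submodule.mem_span_range_iff_exists_fun]
    refine mem_span_of_iInf_ker_le_ker fun x hx => ?_
    have : T x = ⟨x, hx⟩ := by
      have := LinearMap.congr_fun hT ⟨x, hx⟩
      simpa using this
    simp [Q, this]
  choose c hc using hQ
  let r : Fin n → MvPolynomial (Fin n) ℝ := fun k => X k - ∑ i, C (c k i) * q i
  have hr : ∀ x k, eval x (r k) = p k + (T (x - p) : Fin n → ℝ) k := by
    intro x k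
    have := LinearMap.congr_fun (hc k) (x - p)
    simp [Q] at this
    have e : eval x (r k) = x k - ∑ i, c k i * eval x (q i) := by simp [r]
    rw [e]
    simp only [hq]
    simp
    linarith
  have hz : bind₁ r g = 0 := by
    refine MvPolynomial.funext fun x => ?_
    rw [map_zero, eval, eval₂Hom_bind₁]
    refine hg _ fun i => ?_
    rw [hq]
    have : ((fun k => (eval₂Hom (RingHom.id ℝ) x) (r k)) - p) = (T (x - p) : Fin n → ℝ) := by
      ext k
      have := hr x k
      rw [eval] at this
      simp [-coe_eval₂Hom, this]
    rw [this]
    have h2 := (T (x - p)).2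
    rw [Submodule.mem_iInf] at h2
    exact h2 i
  rw [← Ideal.Quotient.eq_zero_iff_mem]
  have h1 : (Ideal.Quotient.mkₐ ℝ (Ideal.span (Set.range q))).comp (bind₁ r) =
      Ideal.Quotient.mkₐ ℝ (Ideal.span (Set.range q)) := by
    ext k
    simp only [AlgHom.comp_apply, bind₁_X_right, Ideal.Quotient.mkₐ_eq_mk]
    rw [Ideal.Quotient.eq]
    have : r k - X k = - ∑ i, C (c k i) * q i := by simp [r]
    rw [this]
    exact Ideal.neg_mem_iff _ |>.2 (Ideal.sum_mem _ fun i _ =>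
      Ideal.mul_mem_left _ _ (Ideal.subset_span ⟨i, rfl⟩))
  have h2 := AlgHom.congr_fun h1 g
  simp only [AlgHom.comp_apply, hz, map_zero, Ideal.Quotient.mkₐ_eq_mk] at h2
  exact h2.symm

lemma sign_eq_iff_pos {σ : SignType} (hσ : σ ≠ 0) (a : ℝ) :
    SignType.sign a = σ ↔ 0 < (σ : ℝ) * a := by
  cases σ
  · exact absurd rfl hσ
  · change SignType.sign a = -1 ↔ _
    rw [sign_eq_neg_one_iff]; simp
  · change SignType.sign a = 1 ↔ _
    rw [sign_eq_one_iff]; simp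

lemma cast_sign_cases {σ : SignType} (hσ : σ ≠ 0) : (σ : ℝ) = 1 ∨ (σ : ℝ) = -1 := by
  cases σ
  · exact absurd rfl hσ
  · right; simp
  · left; simp

lemma chamber_sign_ne_zero {n b : ℕ} (π : Fin b → MvPolynomial (Fin n) ℝ)
    (hπ : ∀ i, (π i).totalDegree = 1) (θ : Fin b → SignType)
    (hcham : (interior (piece π θ)).Nonempty) (i : Fin b) : θ i ≠ 0 := by
  intro h0
  obtain ⟨q, hq⟩ := hcham
  obtain ⟨c, L, hL⟩ := exists_affine_form (π i) (hπ i).le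
  have hz : ∀ x ∈ piece π θ, c + L x = 0 := by
    intro x hx
    have := hx i
    rwa [h0, sign_eq_zero_iff, hL] at this
  have hLz : ∀ v, L v = 0 := by
    intro v
    have hcont : Filter.Tendsto (fun t : ℝ => q + t • v) (nhdsWithin 0 (Set.Ioi 0)) (nhds q) := by
      have : Continuous (fun t : ℝ => q + t • v) := by fun_prop
      simpa using (this.tendsto 0).mono_left nhdsWithin_le_nhds
    have h1 := hcont.eventually (mem_interior_iff_mem_nhds.1 hq)
    obtain ⟨t, ht, ht0⟩ := (h1.and self_mem_nhdsWithin).exists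
    have e1 := hz _ ht
    have e2 := hz _ (interior_subset hq)
    rw [map_add, map_smul, smul_eq_mul] at e1
    have : t * L v = 0 := by linarith
    exact (mul_eq_zero.1 this).resolve_left (ne_of_gt ht0)
  have : π i = C c := MvPolynomial.funext fun x => by rw [hL, hLz]; simp
  have h1 := hπ i
  rw [this, totalDegree_C] at h1
  exact zero_ne_one h1

lemma closure_piece {n b : ℕ} (π : Fin b → MvPolynomial (Fin n) ℝ)
    (hπ : ∀ i, (π i).totalDegree = 1) (θ : Fin b → SignType)
    (hcham : (interior (piece π θ)).Nonempty) :
    closure (piece π θ) = {x | ∀ i, 0 ≤ (θ i : ℝ) * eval x (π i)} := by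
  have hne := chamber_sign_ne_zero π hπ θ hcham
  obtain ⟨q, hq⟩ := hcham
  replace hq := interior_subset hq
  apply Set.Subset.antisymm
  · refine closure_minimal (fun x hx i => ((sign_eq_iff_pos (hne i) _).1 (hx i)).le) ?_
    have : {x | ∀ i, 0 ≤ (θ i : ℝ) * eval x (π i)}
        = ⋂ i, {x | 0 ≤ (θ i : ℝ) * eval x (π i)} := by ext; simp
    rw [this]
    exact isClosed_iInter fun i => isClosed_le continuous_const
      (continuous_const.mul (MvPolynomial.continuous_eval _))
  · intro x hx
    have hcont : Filter.Tendsto (fun t : ℝ => x + t • (q - x))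
        (nhdsWithin 0 (Set.Ioi 0)) (nhds x) := by
      have : Continuous (fun t : ℝ => x + t • (q - x)) := by fun_prop
      simpa using (this.tendsto 0).mono_left nhdsWithin_le_nhds
    refine mem_closure_of_tendsto hcont ?_
    have h1 : ∀ᶠ t : ℝ in nhdsWithin 0 (Set.Ioi 0), t < 1 :=
      nhdsWithin_le_nhds (Iio_mem_nhds one_pos)
    filter_upwards [h1, self_mem_nhdsWithin] with t ht1 ht0 i
    rw [sign_eq_iff_pos (hne i)]
    obtain ⟨c, L, hL⟩ := exists_affine_form (π i) (hπ i).le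
    have hqi := (sign_eq_iff_pos (hne i) _).1 (hq i)
    have hxi := hx i
    rw [hL] at hqi hxi ⊢
    have h3 := mul_pos (Set.mem_Ioi.1 ht0) hqi
    have h4 := mul_nonneg (sub_nonneg.2 ht1.le) hxi
    rw [map_add, map_smul, map_sub, smul_eq_mul]
    nlinarith

lemma exists_generic {n b : ℕ} (c : Fin b → ℝ) (L : Fin b → (Fin n → ℝ) →ₗ[ℝ] ℝ)
    (s s' : Fin b → ℝ) (Z : Set (Fin n → ℝ))
    (hZ : Z = {x | ∀ i, 0 ≤ s i * (c i + L i x) ∧ 0 ≤ s' i * (c i + L i x)})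
    (hs : ∀ i, s i = 1 ∨ s i = -1) (hne : Z.Nonempty) :
    ∃ p ∈ Z, ∀ i, c i + L i p = 0 → ∀ x ∈ Z, c i + L i x = 0 := by
  classical
  have key : ∀ S : Finset (Fin b),
      ∃ p ∈ Z, ∀ i ∈ S, c i + L i p = 0 → ∀ x ∈ Z, c i + L i x = 0 := by
    intro S
    induction S using Finset.induction_on with
    | empty => exact ⟨hne.some, hne.some_mem, by simp⟩
    | insert j S hj ih =>
      obtain ⟨p, hp, h⟩ := ih
      by_cases hall : ∀ x ∈ Z, c j + L j x = 0
      · refine ⟨p, hp, fun i hi h0 => ?_⟩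
        rcases Finset.mem_insert.1 hi with rfl | hi
        · exact hall
        · exact h i hi h0
      · push Not at hall
        obtain ⟨q, hq, hqj⟩ := hall
        have hmid : ∀ i, c i + L i ((1/2 : ℝ) • p + (1/2 : ℝ) • q)
            = ((c i + L i p) + (c i + L i q)) / 2 := by
          intro i; simp; ring
        have hp' := hp
        have hq' := hq
        rw [hZ] at hp' hq'
        have hzero : ∀ i, c i + L i ((1/2 : ℝ) • p + (1/2 : ℝ) • q) = 0 →
            c i + L i p = 0 ∧ c i + L i q = 0 := by
          intro i h0
          rw [hmid] at h0
          have h1 := (hp' i).1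
          have h2 := (hq' i).1
          rcases hs i with e | e <;> rw [e] at h1 h2 <;> constructor <;> linarith
        refine ⟨(1/2 : ℝ) • p + (1/2 : ℝ) • q, ?_, fun i hi h0 => ?_⟩
        · rw [hZ]
          intro i
          rw [hmid]
          constructor
          · have h1 := (hp' i).1
            have h2 := (hq' i).1
            linarith
          · have h1 := (hp' i).2
            have h2 := (hq' i).2
            linarith
        · rcases Finset.mem_insert.1 hi with rfl | hi
          · exact absurd (hzero _ h0).2 hqj
          · exact h i hi (hzero _ h0).1
  obtain ⟨p, hp, h⟩ := key Finset.univ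
  exact ⟨p, hp, fun i => h i (Finset.mem_univ i)⟩

/-- For closures `V`, `W` of two distinct chambers of a hyperplane partition
with `V ∩ W ≠ ∅`, the separating ideal `⟨V, W⟩` equals the vanishing ideal of
the affine span of `V ∩ W`. -/
theorem sepIdeal_eq_vanishing_ideal_of_affineSpan {n b : ℕ}
    (π : Fin b → MvPolynomial (Fin n) ℝ) (hπ : ∀ i, (π i).totalDegree = 1)
    (θ θ' : Fin b → SignType)
    (hcham : (interior (piece π θ)).Nonempty)
    (hcham' : (interior (piece π θ')).Nonempty)
    (hne : piece π θ ≠ piece π θ')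
    (V W : Set (Fin n → ℝ))
    (hV : V = closure (piece π θ)) (hW : W = closure (piece π θ'))
    (hVW : (V ∩ W).Nonempty) :
    ∀ g : MvPolynomial (Fin n) ℝ,
      g ∈ sepIdeal V W ↔
        ∀ x ∈ (affineSpan ℝ (V ∩ W) : Set (Fin n → ℝ)), eval x g = 0 := by
  subst hV hW
  have hθ := chamber_sign_ne_zero π hπ θ hcham
  have hθ' := chamber_sign_ne_zero π hπ θ' hcham'
  rw [closure_piece π hπ θ hcham, closure_piece π hπ θ' hcham'] at *
  set V : Set (Fin n → ℝ) := {x | ∀ i, 0 ≤ (θ i : ℝ) * eval x (π i)} with hV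
  set W : Set (Fin n → ℝ) := {x | ∀ i, 0 ≤ (θ' i : ℝ) * eval x (π i)} with hW
  have hform := fun i => exists_affine_form (π i) (hπ i).le
  choose c L hL using hform
  have hs := fun i => cast_sign_cases (hθ i)
  have hs' := fun i => cast_sign_cases (hθ' i)
  set s : Fin b → ℝ := fun i => (θ i : ℝ) with hsdef
  set s' : Fin b → ℝ := fun i => (θ' i : ℝ) with hsdef'
  obtain ⟨p, hp, hgen⟩ := exists_generic c L s s' (V ∩ W) (by
    ext x
    simp only [hV, hW, hL, Set.mem_inter_iff, Set.mem_ofPred_eq]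
    exact forall_and.symm) hs hVW
  -- the local structure at `p`
  let ι := {i : Fin b // c i + L i p = 0}
  have hι : ∀ (i : ι) x, eval x (π i) = L i (x - p) := by
    intro i x
    have := i.2
    rw [hL, map_sub]; linarith
  have hlocal : ∀ v : Fin n → ℝ, (∀ i : ι, 0 ≤ s i * L i v ∧ 0 ≤ s' i * L i v) →
      ∀ᶠ t : ℝ in nhdsWithin 0 (Set.Ioi 0), p + t • v ∈ V ∩ W := by
    intro v hv
    have hev : ∀ i, ∀ᶠ t : ℝ in nhdsWithin 0 (Set.Ioi 0),
        0 ≤ s i * eval (p + t • v) (π i) ∧ 0 ≤ s' i * eval (p + t • v) (π i) := by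
      intro i
      by_cases hi : c i + L i p = 0
      · filter_upwards [self_mem_nhdsWithin] with t ht
        have ht' : (0 : ℝ) ≤ t := le_of_lt ht
        have h1 := mul_nonneg ht' (hv ⟨i, hi⟩).1
        have h2 := mul_nonneg ht' (hv ⟨i, hi⟩).2
        rw [hι ⟨i, hi⟩, add_sub_cancel_left, map_smul, smul_eq_mul]
        constructor <;> linarith
      · have hcont : Continuous (fun t : ℝ => eval (p + t • v) (π i)) :=
          (MvPolynomial.continuous_eval (π i)).comp (by fun_prop)
        have aux : ∀ r : ℝ, (r = 1 ∨ r = -1) → 0 ≤ r * eval p (π i) →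
            ∀ᶠ t : ℝ in nhdsWithin 0 (Set.Ioi 0), 0 ≤ r * eval (p + t • v) (π i) := by
          intro r hr hr0
          have hpos : 0 < r * eval p (π i) := by
            refine lt_of_le_of_ne hr0 (Ne.symm (mul_ne_zero ?_ ?_))
            · rcases hr with h | h <;> rw [h] <;> norm_num
            · rwa [hL]
          have h1 : Filter.Tendsto (fun t : ℝ => r * eval (p + t • v) (π i))
              (nhdsWithin 0 (Set.Ioi 0)) (nhds (r * eval p (π i))) := by
            have hc2 : Continuous (fun t : ℝ => r * eval (p + t • v) (π i)) :=
              continuous_const.mul hcont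
            simpa using (hc2.tendsto (0 : ℝ)).mono_left
              (nhdsWithin_le_nhds (s := Set.Ioi (0 : ℝ)))
          filter_upwards [h1.eventually (Ioi_mem_nhds hpos)] with t ht
          exact le_of_lt ht
        exact (aux _ (hs i) (hp.1 i)).and (aux _ (hs' i) (hp.2 i))
    filter_upwards [Filter.eventually_all.2 hev] with t ht
    exact ⟨fun i => (ht i).1, fun i => (ht i).2⟩
  -- the affine span
  have hspan : ∀ x, x ∈ affineSpan ℝ (V ∩ W) ↔ ∀ i : ι, eval x (π i) = 0 := by
    intro x
    constructor
    · intro hx i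
      refine affineSpan_induction (p := fun x => eval x (π i) = 0) hx ?_ ?_
      · intro y hy
        rw [hL]
        exact hgen i i.2 y hy
      · intro a u v w hu hv hw
        simp only [hL] at hu hv hw ⊢
        simp only [vsub_eq_sub, vadd_eq_add, map_add, map_smul, map_sub, smul_eq_mul]
        linear_combination a * hu - a * hv + hw
    · intro hx
      have h1 := hlocal (x - p) (fun i => by rw [← hι i, hx i]; simp)
      obtain ⟨t, ht, ht0⟩ := (h1.and self_mem_nhdsWithin).exists
      have h2 := AffineMap.lineMap_mem t⁻¹ (subset_affineSpan ℝ _ hp) (subset_affineSpan ℝ _ ht)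
      convert h2 using 1
      have : t ≠ 0 := ne_of_gt ht0
      simp [AffineMap.lineMap_apply, smul_smul, this]
  intro g
  constructor
  · intro hg x hx
    have hx' := (hspan x).1 hx
    have hgz : ∀ y ∈ V ∩ W, eval y g = 0 := by
      intro y hy
      have : sepIdeal V W ≤ RingHom.ker (eval y) := by
        refine Ideal.span_le.2 fun h hh => ?_
        exact le_antisymm (hh.2 y hy.2) (hh.1 y hy.1)
      exact this hg
    -- restrict to the line from `p` to `x`
    let G : Polynomial ℝ := aeval (fun k => Polynomial.C (p k) + Polynomial.X * Polynomial.C (x k - p k)) g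
    have hG : ∀ t : ℝ, G.eval t = eval (p + t • (x - p)) g := by
      intro t
      have : ((Polynomial.aeval t).comp (aeval (fun k => Polynomial.C (p k) + Polynomial.X * Polynomial.C (x k - p k)))) =
          (aeval (p + t • (x - p)) : MvPolynomial (Fin n) ℝ →ₐ[ℝ] ℝ) := by
        ext k
        simp
      have h2 := AlgHom.congr_fun this g
      simpa [G, Polynomial.coe_aeval_eq_eval, MvPolynomial.coe_aeval_eq_eval] using h2
    have h1 := hlocal (x - p) (fun i => by rw [← hι i, hx' i]; simp)
    have hinf : Set.Infinite {t | G.IsRoot t} := by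
      have h3 : {t | G.IsRoot t} ∈ nhdsWithin (0 : ℝ) (Set.Ioi 0) := by
        filter_upwards [h1] with t ht
        exact (hG t).trans (hgz _ ht)
      obtain ⟨u, hu, hsub⟩ := mem_nhdsGT_iff_exists_Ioo_subset.1 h3
      exact (Set.Ioo_infinite hu).mono hsub
    have h0 := Polynomial.eq_zero_of_infinite_isRoot G hinf
    have := hG 1
    rw [h0] at this
    simpa using this.symm
  · intro hg
    have hmem := mem_span_of_vanish (fun i : ι => π i) (fun i => L i) p hι g
      (fun x hx => hg x ((hspan x).2 hx))
    refine Ideal.span_le.2 ?_ hmem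
    rintro _ ⟨j, rfl⟩
    let F : (Fin n → ℝ) →ₗ[ℝ] (ι → ℝ) := LinearMap.pi fun i => L i
    obtain ⟨f, ε, hε, hf1, hf2⟩ := strict_sep (LinearMap.range F) (fun i => s i) (fun i => s' i)
      (fun i => hs i) (fun i => hs' i) (by
        rintro _ ⟨v, rfl⟩ h1 h2
        have h3 := hlocal v (fun i => ⟨h1 i, h2 i⟩)
        obtain ⟨t, ht, ht0⟩ := (h3.and self_mem_nhdsWithin).exists
        ext i
        have h4 := hgen i i.2 _ ht
        rw [← hL, hι i, add_sub_cancel_left, map_smul, smul_eq_mul] at h4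
        exact (mul_eq_zero.1 h4).resolve_left (ne_of_gt ht0))
    classical
    let q0 : MvPolynomial (Fin n) ℝ := ∑ i : ι, C (f (Pi.single i 1)) * π i
    have hq0 : ∀ x, eval x q0 = f (F (x - p)) := by
      intro x
      have e : F (x - p) = ∑ i : ι, (L i (x - p)) • (Pi.single i 1 : ι → ℝ) := by
        ext k
        rw [Finset.sum_apply, Finset.sum_eq_single k]
        · simp [F, -map_sub]
        · intro i _ hi
          simp [Pi.single_eq_of_ne (Ne.symm hi), -map_sub]
        · intro hk
          exact absurd (Finset.mem_univ k) hk
      rw [e, map_sum]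
      simp only [q0, map_sum, map_mul, eval_C, hι, map_smul, smul_eq_mul]
      exact Finset.sum_congr rfl fun i _ => mul_comm _ _
    have hb : ∀ (r : ι → ℝ) (hr : ∀ i, r i = 1 ∨ r i = -1) (y : ι → ℝ),
        (∀ i, 0 ≤ r i * y i) → 0 ≤ ∑ i, r i * y i ∧ |y j| ≤ ∑ i, r i * y i := by
      intro r hr y hy
      refine ⟨Finset.sum_nonneg fun i _ => hy i, ?_⟩
      refine le_trans ?_ (Finset.single_le_sum (fun i _ => hy i) (Finset.mem_univ j))
      have := hy j
      rcases hr j with e | e <;> rw [e] at this ⊢ <;> rw [abs_le] <;> constructor <;> linarith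
    have hA : ∀ a : ℝ, |a| ≤ ε → q0 + C a * π j ∈ sepIdeal V W := by
      intro a ha
      refine Ideal.subset_span ⟨fun x hx => ?_, fun x hx => ?_⟩
      · have hy : ∀ i : ι, 0 ≤ s i * F (x - p) i := fun i => by
          have := hx i
          rw [hι i] at this
          exact this
        have h1 := hf1 _ ⟨_, rfl⟩ hy
        obtain ⟨h2, h3⟩ := hb (fun i => s i) (fun i => hs i) _ hy
        have h4 : |a * F (x - p) j| ≤ ε * ∑ i : ι, s i * F (x - p) i := by
          rw [abs_mul]; exact mul_le_mul ha h3 (abs_nonneg _) hε.le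
        rw [map_add, map_mul, eval_C, hq0, hι j]
        have h5 := (abs_le.1 h4).1
        change 0 ≤ f (F (x - p)) + a * F (x - p) j
        linarith
      · have hy : ∀ i : ι, 0 ≤ s' i * F (x - p) i := fun i => by
          have := hx i
          rw [hι i] at this
          exact this
        have h1 := hf2 _ ⟨_, rfl⟩ hy
        obtain ⟨h2, h3⟩ := hb (fun i => s' i) (fun i => hs' i) _ hy
        have h4 : |a * F (x - p) j| ≤ ε * ∑ i : ι, s' i * F (x - p) i := by
          rw [abs_mul]; exact mul_le_mul ha h3 (abs_nonneg _) hε.le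
        rw [map_add, map_mul, eval_C, hq0, hι j]
        have h5 := (abs_le.1 h4).2
        change f (F (x - p)) + a * F (x - p) j ≤ 0
        linarith
    have h1 := hA 0 (by simpa using hε.le)
    have h2 := hA ε (by rw [abs_of_pos hε])
    have h3 := Ideal.mul_mem_left _ (C ε⁻¹) (Ideal.sub_mem _ h2 h1)
    have e : C ε⁻¹ * (q0 + C ε * π j - (q0 + C 0 * π j)) = π j := by
      have : (C ε⁻¹ * C ε : MvPolynomial (Fin n) ℝ) = 1 := by
        rw [← C_mul, inv_mul_cancel₀ hε.ne', C_1]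
      rw [C_0]
      linear_combination (π j) * this
    rw [e] at h3
    exact h3
end

section
/- Let V, W ⊆ ℝⁿ be convex sets and let x be a point in the relative interior (intrinsic interior) of V ∩ W. Then {d ∈ ℝⁿ : ∃ t > 0 with x + t·d ∈ V} ∩ {d ∈ ℝⁿ : ∃ t > 0 with x + t·d ∈ W} = {d ∈ ℝⁿ : x + d lies in the affine span of V ∩ W}. In words, the intersection of the cones of feasible directions of V and W at x equals the direction space of the affine span of V ∩ W. -/
/-- For convex sets `V, W ⊆ ℝⁿ` and a point `x` in the relative interior of
`V ∩ W`, the intersection of the cones of feasible directions of `V` and `W`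
at `x` equals the direction space of the affine span of `V ∩ W`. -/
theorem feasible_directions_inter_eq_affineSpan_directions {n : ℕ}
    (V W : Set (Fin n → ℝ)) (hV : Convex ℝ V) (hW : Convex ℝ W)
    (x : Fin n → ℝ) (hx : x ∈ intrinsicInterior ℝ (V ∩ W)) :
    {d : Fin n → ℝ | ∃ t : ℝ, 0 < t ∧ x + t • d ∈ V} ∩
      {d : Fin n → ℝ | ∃ t : ℝ, 0 < t ∧ x + t • d ∈ W} =
    {d : Fin n → ℝ | x + d ∈ affineSpan ℝ (V ∩ W)} := by
  obtain ⟨y, hy, rfl⟩ := mem_intrinsicInterior.1 hx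
  have hyVW : (y : Fin n → ℝ) ∈ V ∩ W := intrinsicInterior_subset hx
  have shrink : ∀ (S : Set (Fin n → ℝ)), Convex ℝ S → (y : Fin n → ℝ) ∈ S →
      ∀ (d : Fin n → ℝ) (s t : ℝ), 0 < s → s ≤ t → (y : Fin n → ℝ) + t • d ∈ S →
        (y : Fin n → ℝ) + s • d ∈ S := by
    intro S hS hyS d s t hs hst h
    have ht : 0 < t := hs.trans_le hst
    have h2 := hS.add_smul_mem hyS h (t := s / t) ⟨by positivity, (div_le_one ht).2 hst⟩
    rwa [smul_smul, div_mul_cancel₀ _ ht.ne'] at h2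
  have line : ∀ (d : Fin n → ℝ) (t s : ℝ), t ≠ 0 →
      (y : Fin n → ℝ) + t • d ∈ affineSpan ℝ (V ∩ W) →
        (y : Fin n → ℝ) + s • d ∈ affineSpan ℝ (V ∩ W) := by
    intro d t s ht h
    have h2 := AffineMap.lineMap_mem (s / t) y.2 h
    rw [AffineMap.lineMap_apply] at h2
    simp only [vsub_eq_sub, vadd_eq_add, add_sub_cancel_left, smul_smul,
      div_mul_cancel₀ _ ht] at h2
    rwa [add_comm]
  ext d
  simp only [Set.mem_inter_iff, Set.mem_setOf_eq]
  constructor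
  · rintro ⟨⟨t₁, h₁, hv⟩, ⟨t₂, h₂, hw⟩⟩
    have hm : 0 < min t₁ t₂ := lt_min h₁ h₂
    have h := line d (min t₁ t₂) 1 hm.ne' (subset_affineSpan ℝ _
      ⟨shrink V hV hyVW.1 d _ t₁ hm (min_le_left _ _) hv,
        shrink W hW hyVW.2 d _ t₂ hm (min_le_right _ _) hw⟩)
    rwa [one_smul] at h
  · intro hd
    have hl : ∀ s : ℝ, (y : Fin n → ℝ) + s • d ∈ affineSpan ℝ (V ∩ W) := fun s =>
      line d 1 s one_ne_zero (by rwa [one_smul])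
    let f : ℝ → affineSpan ℝ (V ∩ W) := fun s => ⟨(y : Fin n → ℝ) + s • d, hl s⟩
    have hf : Continuous f := by
      apply Continuous.subtype_mk
      fun_prop
    have hf0 : f 0 = y := by
      apply Subtype.ext
      simp [f]
    have hn := hf.continuousAt.preimage_mem_nhds (x := 0)
      (by rw [hf0]; exact mem_interior_iff_mem_nhds.1 hy)
    obtain ⟨ε, hε, hb⟩ := Metric.mem_nhds_iff.1 hn
    have hmem : (y : Fin n → ℝ) + (ε / 2) • d ∈ V ∩ W := by
      apply @hb (ε / 2)
      rw [Metric.mem_ball, Real.dist_eq, sub_zero, abs_of_pos (by positivity)]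
      linarith
    exact ⟨⟨ε / 2, by positivity, hmem.1⟩, ⟨ε / 2, by positivity, hmem.2⟩⟩
end

section
/- Let π₁,…,π_b ∈ ℝ[x₁,…,x_n] be nonconstant polynomials of degree one inducing a hyperplane partition of ℝⁿ, let Π and Π' be two distinct chambers, and let V, W be their Euclidean closures with V ∩ W ≠ ∅. Let n' be the dimension of the affine span of V ∩ W. Then there exist q ≤ n − n' + 1 (in particular q ≤ n + 1) degree-one polynomials π'₁,…,π'_q ∈ ℝ[x₁,…,x_n], each satisfying π'_k ≥ 0 on V and π'_k ≤ 0 on W, which generate the vanishing ideal of the affine span of V ∩ W. -/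
open MvPolynomial

/-- The vanishing ideal of a subset `A ⊆ ℝⁿ`: all polynomials vanishing
identically on `A`. -/
noncomputable def polyVanishingIdeal {n : ℕ} (A : Set (Fin n → ℝ)) :
    Ideal (MvPolynomial (Fin n) ℝ) where
  carrier := {g | ∀ x ∈ A, eval x g = 0}
  add_mem' := by
    intro a b ha hb x hx
    simp [map_add, ha x hx, hb x hx]
  zero_mem' := by
    intro x hx
    simp
  smul_mem' := by
    intro c a ha x hx
    simp [smul_eq_mul, ha x hx]


theorem stiemke {J : Type} [Fintype J] {E : Type} [AddCommGroup E] [Module ℝ E]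
    (K : Submodule ℝ E) (g : J → Module.Dual ℝ E)
    (h : ∀ v ∈ K, (∀ j, 0 ≤ g j v) → ∀ j, g j v = 0) :
    ∃ lam : J → ℝ, (∀ j, 0 < lam j) ∧ ∀ v ∈ K, ∑ j, lam j * g j v = 0 := by
  classical
  let G : E →ₗ[ℝ] (J → ℝ) := LinearMap.pi g
  let M : Submodule ℝ (J → ℝ) := K.map G
  have hdisj : Disjoint (stdSimplex ℝ J) (M : Set (J → ℝ)) := by
    rw [Set.disjoint_left]
    rintro x ⟨hx0, hx1⟩ ⟨v, hv, rfl⟩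
    have h2 := h v hv hx0
    have : ∑ j, G v j = 0 := Finset.sum_eq_zero fun j _ => h2 j
    linarith
  obtain ⟨f, u, v, h1, h2, h3⟩ := geometric_hahn_banach_compact_closed
    (convex_stdSimplex ℝ J) (isCompact_stdSimplex ℝ J) M.convex M.closed_of_finiteDimensional hdisj
  have hv0 : v < 0 := by simpa using h3 0 M.zero_mem
  have hM : ∀ y ∈ M, f y = 0 := by
    intro y hy
    by_contra hne
    have := h3 (((v - 1) / f y) • y) (M.smul_mem _ hy)
    rw [map_smul, smul_eq_mul, div_mul_cancel₀ _ hne] at this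
    linarith
  refine ⟨fun j => - f (Pi.single j 1), fun j => ?_, fun w hw => ?_⟩
  · have := h1 _ (single_mem_stdSimplex ℝ j)
    linarith
  · have h4 := hM _ (Submodule.mem_map_of_mem (f := G) hw)
    rw [← Finset.univ_sum_single (G w), map_sum] at h4
    rw [← neg_eq_zero, ← h4, ← Finset.sum_neg_distrib]
    refine Finset.sum_congr rfl fun j _ => ?_
    have : Pi.single j (G w j) = (g j w) • (Pi.single j 1 : J → ℝ) := by
      rw [← Pi.single_smul]; simp [G]
    rw [this, map_smul, smul_eq_mul]; ring

/-- The affine polynomial `x ↦ l x - l x0`. -/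
noncomputable def affPoly {n : ℕ} (l : Module.Dual ℝ (Fin n → ℝ)) (x0 : Fin n → ℝ) :
    MvPolynomial (Fin n) ℝ :=
  ∑ i, C (l (Pi.single i 1)) * X i - C (l x0)

theorem dual_eq_sum {n : ℕ} (l : Module.Dual ℝ (Fin n → ℝ)) (x : Fin n → ℝ) :
    l x = ∑ i, l (Pi.single i 1) * x i := by
  conv_lhs => rw [← Finset.univ_sum_single x, map_sum]
  refine Finset.sum_congr rfl fun j _ => ?_
  have : Pi.single j (x j) = (x j) • (Pi.single j 1 : Fin n → ℝ) := by
    rw [← Pi.single_smul]; simp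
  rw [this, map_smul, smul_eq_mul]; ring

theorem eval_affPoly {n : ℕ} (l : Module.Dual ℝ (Fin n → ℝ)) (x0 x : Fin n → ℝ) :
    eval x (affPoly l x0) = l x - l x0 := by
  simp [affPoly, dual_eq_sum l x]

theorem totalDegree_affPoly {n : ℕ} (l : Module.Dual ℝ (Fin n → ℝ)) (x0 : Fin n → ℝ)
    (hl : l ≠ 0) : (affPoly l x0).totalDegree = 1 := by
  apply le_antisymm
  · refine (totalDegree_sub_C_le _ _).trans ?_
    refine (totalDegree_finsetSum _ _).trans (Finset.sup_le fun i _ => ?_)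
    refine (totalDegree_mul _ _).trans ?_
    simp
  · by_contra hlt
    have h0 : (affPoly l x0).totalDegree = 0 := by omega
    rw [totalDegree_eq_zero_iff_eq_C] at h0
    apply hl
    ext i
    have h1 := eval_affPoly l x0 (Pi.single i 1)
    have h2 := eval_affPoly l x0 0
    rw [h0, eval_C] at h1 h2
    simp at h2 ⊢
    linarith

theorem exists_affine_of_totalDegree {n : ℕ} (p : MvPolynomial (Fin n) ℝ)
    (hp : p.totalDegree = 1) : ∃ (a : Module.Dual ℝ (Fin n → ℝ)) (c : ℝ), a ≠ 0 ∧
      ∀ x, eval x p = a x + c := by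
  have key : ∀ d ∈ p.support, ∃ (a : Module.Dual ℝ (Fin n → ℝ)) (c : ℝ), 
      ∀ x, eval x (monomial d (coeff d p)) = a x + c := by
    intro d hd
    have h1 := le_totalDegree hd
    rw [hp] at h1
    by_cases h0 : d = 0
    · subst h0
      exact ⟨0, coeff 0 p, fun x => by simp⟩
    · obtain ⟨i, hi⟩ : ∃ i, d i ≠ 0 := by
        by_contra hcon; push Not at hcon; exact h0 (Finsupp.ext hcon)
      have hs : d = Finsupp.single i 1 := by
        rw [Finsupp.sum_fintype _ _ (by simp)] at h1
        have h2 := Finset.add_sum_erase Finset.univ (fun i => d i) (Finset.mem_univ i)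
        ext j
        by_cases hj : j = i
        · subst hj; rw [Finsupp.single_eq_same]; omega
        · have h3 := Finset.single_le_sum (f := fun i => d i) (fun _ _ => Nat.zero_le _)
            (Finset.mem_erase.2 ⟨hj, Finset.mem_univ j⟩)
          rw [Finsupp.single_eq_of_ne hj]
          omega
      refine ⟨coeff d p • LinearMap.proj i, 0, fun x => ?_⟩
      rw [eval_monomial, hs]
      simp
  choose! a c hac using key
  have hev : ∀ x, eval x p = (∑ d ∈ p.support, a d) x + ∑ d ∈ p.support, c d := by
    intro x
    conv_lhs => rw [p.as_sum, map_sum]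
    rw [LinearMap.sum_apply, ← Finset.sum_add_distrib]
    exact Finset.sum_congr rfl fun d hd => hac d hd x
  refine ⟨_, _, ?_, hev⟩
  intro h0
  have : p = C (∑ d ∈ p.support, c d) := by
    apply MvPolynomial.funext
    intro x; rw [hev x, h0]; simp
  rw [this, totalDegree_C] at hp
  omega

theorem span_affPoly {n q : ℕ} (L : Submodule ℝ (Fin n → ℝ)) (x0 : Fin n → ℝ)
    (l : Fin q → Module.Dual ℝ (Fin n → ℝ))
    (hl : Submodule.span ℝ (Set.range l) = L.dualAnnihilator)
    (A : Set (Fin n → ℝ)) (hA : ∀ x, x ∈ A ↔ x - x0 ∈ L) :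
    Ideal.span (Set.range fun k => affPoly (l k) x0) = polyVanishingIdeal A := by
  have hmem : ∀ m ∈ L.dualAnnihilator,
      affPoly m x0 ∈ Ideal.span (Set.range fun k => affPoly (l k) x0) := by
    intro m hm
    rw [← hl] at hm
    induction hm using Submodule.span_induction with
    | mem x hx =>
      obtain ⟨k, rfl⟩ := hx
      exact Ideal.subset_span ⟨k, rfl⟩
    | zero => simp [affPoly]
    | add x y _ _ hx hy =>
      have : affPoly (x + y) x0 = affPoly x x0 + affPoly y x0 := by
        apply MvPolynomial.funext
        intro z; simp [eval_affPoly]; ring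
      rw [this]; exact Ideal.add_mem _ hx hy
    | smul r x _ hx =>
      have : affPoly (r • x) x0 = C r * affPoly x x0 := by
        apply MvPolynomial.funext
        intro z; simp [eval_affPoly]; ring
      rw [this]; exact Ideal.mul_mem_left _ _ hx
  apply le_antisymm
  · rw [Ideal.span_le]
    rintro _ ⟨k, rfl⟩ x hx
    have hk : l k ∈ L.dualAnnihilator := hl ▸ Submodule.subset_span ⟨k, rfl⟩
    rw [Submodule.mem_dualAnnihilator] at hk
    rw [eval_affPoly, ← map_sub]
    exact hk _ ((hA x).1 hx)
  · intro g hg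
    obtain ⟨L', hL'⟩ := L.exists_isCompl
    let P : (Fin n → ℝ) →ₗ[ℝ] (Fin n → ℝ) := L.subtype ∘ₗ L.projectionOnto L' hL'
    have hP1 : ∀ x, P x ∈ L := fun x => (L.projectionOnto L' hL' x).2
    have hP2 : ∀ x ∈ L, P x = x := fun x hx => by
      simp [P, Submodule.projectionOnto_apply_left hL' ⟨x, hx⟩]
    let m : Fin n → Module.Dual ℝ (Fin n → ℝ) := fun i => LinearMap.proj i ∘ₗ (LinearMap.id - P)
    have hm : ∀ i, m i ∈ L.dualAnnihilator := by
      intro i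
      rw [Submodule.mem_dualAnnihilator]
      intro x hx
      simp [m, hP2 x hx]
    let φ : Fin n → MvPolynomial (Fin n) ℝ := fun i => X i - affPoly (m i) x0
    have h0 : aeval φ g = 0 := by
      apply MvPolynomial.funext
      intro x
      have h1 : ∀ g, eval x (aeval φ g) = eval (fun i => eval x (φ i)) g := by
        intro g
        induction g using MvPolynomial.induction_on with
        | C a => simp
        | add p q hp hq => rw [map_add, map_add, map_add, hp, hq]
        | mul_X p i hp => rw [map_mul, map_mul, map_mul, hp, aeval_X, eval_X]
      rw [h1, map_zero]
      apply hg
      rw [hA]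
      have : (fun i => eval x (φ i)) - x0 = P (x - x0) := by
        ext i
        simp [φ, eval_affPoly, m]
        ring
      rw [this]; exact hP1 _
    have h2 : (Ideal.Quotient.mkₐ ℝ (Ideal.span (Set.range fun k => affPoly (l k) x0))).comp (aeval φ)
        = Ideal.Quotient.mkₐ ℝ (Ideal.span (Set.range fun k => affPoly (l k) x0)) := by
      apply MvPolynomial.algHom_ext
      intro i
      simp only [AlgHom.comp_apply, aeval_X, φ, map_sub, Ideal.Quotient.mkₐ_eq_mk]
      rw [Ideal.Quotient.eq_zero_iff_mem.2 (hmem _ (hm i)), sub_zero]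
    have h3 := DFunLike.congr_fun h2 g
    rw [AlgHom.comp_apply, h0, map_zero] at h3
    exact Ideal.Quotient.eq_zero_iff_mem.1 h3.symm

theorem core {n b : ℕ} (a : Fin b → Module.Dual ℝ (Fin n → ℝ)) (c ε : Fin b → ℝ)
    (hε : ∀ i, ε i = 1 ∨ ε i = -1) (V W : Set (Fin n → ℝ))
    (hV : ∀ x, x ∈ V ↔ ∀ i, 0 ≤ a i x + c i)
    (hW : ∀ x, x ∈ W ↔ ∀ i, 0 ≤ ε i * (a i x + c i))
    (hne : (V ∩ W).Nonempty) :
    ∃ x1 ∈ V ∩ W, (affineSpan ℝ (V ∩ W)).direction.dualAnnihilator ≤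
      Submodule.span ℝ {l : Module.Dual ℝ (Fin n → ℝ) |
        (∀ x ∈ V, l x1 ≤ l x) ∧ ∀ x ∈ W, l x ≤ l x1} := by
  classical
  -- a point in the relative interior
  have hrel : ∀ s : Finset (Fin b), ∃ x1 ∈ V ∩ W, ∀ i ∈ s, a i x1 + c i = 0 →
      ∀ x ∈ V ∩ W, a i x + c i = 0 := by
    intro s
    induction s using Finset.induction_on with
    | empty => exact ⟨hne.some, hne.some_mem, by simp⟩
    | insert i s _ ih =>
      obtain ⟨x1, hx1, h1⟩ := ih
      by_cases hy : ∃ y ∈ V ∩ W, a i y + c i ≠ 0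
      · obtain ⟨y, hy, hyi⟩ := hy
        have hval : ∀ k, a k ((1/2 : ℝ) • (x1 + y)) + c k
            = ((a k x1 + c k) + (a k y + c k)) / 2 := by
          intro k; rw [map_smul, map_add, smul_eq_mul]; ring
        have hx1V := (hV _).1 hx1.1
        have hx1W := (hW _).1 hx1.2
        have hyV := (hV _).1 hy.1
        have hyW := (hW _).1 hy.2
        refine ⟨(1/2 : ℝ) • (x1 + y), ⟨(hV _).2 fun k => ?_, (hW _).2 fun k => ?_⟩, ?_⟩
        · rw [hval]; linarith [hx1V k, hyV k]
        · rw [hval]; linarith [hx1W k, hyW k]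
        · intro k hk h0
          rw [hval] at h0
          rcases Finset.mem_insert.1 hk with rfl | hk
          · exact absurd (by linarith [hx1V k, hyV k]) hyi
          · exact h1 k hk (by linarith [hx1V k, hyV k])
      · push Not at hy
        refine ⟨x1, hx1, fun k hk => ?_⟩
        rcases Finset.mem_insert.1 hk with rfl | hk
        · exact fun _ => hy
        · exact h1 k hk
  obtain ⟨x1, hx1, hact⟩ := hrel Finset.univ
  replace hact := fun i => hact i (Finset.mem_univ i)
  have hx1V := (hV _).1 hx1.1
  have hx1W := (hW _).1 hx1.2
  have hS : ∀ i, ε i = -1 → a i x1 + c i = 0 := by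
    intro i hi
    have h1 := hx1V i
    have h2 := hx1W i
    rw [hi] at h2
    linarith
  -- small steps
  have hstep : ∀ v, (∀ i, a i x1 + c i = 0 → 0 ≤ a i v) → (∀ i, ε i = -1 → a i v = 0) →
      ∃ t : ℝ, 0 < t ∧ x1 + t • v ∈ V ∩ W := by
    intro v hv1 hv2
    have hval : ∀ (t : ℝ) k, a k (x1 + t • v) + c k = (a k x1 + c k) + t * a k v := by
      intro t k; rw [map_add, map_smul, smul_eq_mul]; ring
    have hev : ∀ᶠ t : ℝ in nhdsWithin 0 (Set.Ioi 0), ∀ i, 0 ≤ (a i x1 + c i) + t * a i v := by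
      rw [Filter.eventually_all]
      intro i
      by_cases hi : a i x1 + c i = 0
      · filter_upwards [self_mem_nhdsWithin] with t ht
        rw [hi, zero_add]
        exact mul_nonneg (le_of_lt ht) (hv1 i hi)
      · have hpos : 0 < a i x1 + c i := lt_of_le_of_ne (hx1V i) (Ne.symm hi)
        have hcont : Continuous fun t : ℝ => (a i x1 + c i) + t * a i v := by fun_prop
        have := (hcont.tendsto 0).eventually (lt_mem_nhds (a := (0 : ℝ)) (by simpa using hpos))
        exact (this.filter_mono nhdsWithin_le_nhds).mono fun t ht => le_of_lt ht
    obtain ⟨t, ht, ht0⟩ := (hev.and self_mem_nhdsWithin).exists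
    refine ⟨t, ht0, (hV _).2 fun k => ?_, (hW _).2 fun k => ?_⟩
    · rw [hval]; exact ht k
    · rw [hval]
      rcases hε k with h | h
      · rw [h, one_mul]; exact ht k
      · rw [hS k h, hv2 k h]; simp
  have hzero : ∀ v, (∀ i, a i x1 + c i = 0 → 0 ≤ a i v) → (∀ i, ε i = -1 → a i v = 0) →
      ∀ i, a i x1 + c i = 0 → a i v = 0 := by
    intro v hv1 hv2 i hi
    obtain ⟨t, ht, hmem⟩ := hstep v hv1 hv2
    have := hact i hi _ hmem
    rw [map_add, map_smul, smul_eq_mul] at this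
    have h2 : t * a i v = 0 := by linarith
    exact (mul_eq_zero.1 h2).resolve_left ht.ne'
  refine ⟨x1, hx1, ?_⟩
  set D := {l : Module.Dual ℝ (Fin n → ℝ) |
        (∀ x ∈ V, l x1 ≤ l x) ∧ ∀ x ∈ W, l x ≤ l x1} with hD
  -- the separating coordinates
  have hSD : ∀ i, ε i = -1 → a i ∈ D := by
    intro i hi
    refine ⟨fun x hx => ?_, fun x hx => ?_⟩
    · have := (hV x).1 hx i
      linarith [hS i hi]
    · have := (hW x).1 hx i
      rw [hi] at this
      linarith [hS i hi]
  let J := {i : Fin b // a i x1 + c i = 0 ∧ ε i = 1}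
  let S := {i : Fin b // ε i = -1}
  obtain ⟨lam, hlam, hsum⟩ := stiemke (J := J) (⨅ i : S, LinearMap.ker (a i.1)) (fun j => a j.1) (by
    intro v hv hv1 j
    simp only [Submodule.mem_iInf, LinearMap.mem_ker] at hv
    refine hzero v (fun i hi => ?_) (fun i hi => hv ⟨i, hi⟩) j.1 j.2.1
    rcases hε i with h | h
    · exact hv1 ⟨i, hi, h⟩
    · exact (hv ⟨i, h⟩).ge)
  have hspan : (∑ j : J, lam j • a j.1) ∈ Submodule.span ℝ (Set.range fun i : S => a i.1) := by
    apply mem_span_of_iInf_ker_le_ker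
    intro v hv
    rw [LinearMap.mem_ker, LinearMap.sum_apply]
    simpa using hsum v hv
  obtain ⟨d, hd⟩ := (Submodule.mem_span_range_iff_exists_fun ℝ).1 hspan
  have hJD : ∀ j : J, a j.1 ∈ Submodule.span ℝ D := by
    intro j
    let m : Module.Dual ℝ (Fin n → ℝ) := lam j • a j.1 + ∑ i : S, (d i)⁻ • a i.1
    have hm2 : m = ∑ i : S, (d i)⁺ • a i.1 - ∑ k ∈ Finset.univ.erase j, lam k • a k.1 := by
      have h1 := Finset.add_sum_erase Finset.univ (fun k : J => lam k • a k.1) (Finset.mem_univ j)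
      have h2 : ∑ i : S, d i • a i.1 = ∑ i : S, (d i)⁺ • a i.1 - ∑ i : S, (d i)⁻ • a i.1 := by
        rw [← Finset.sum_sub_distrib]
        refine Finset.sum_congr rfl fun i _ => ?_
        conv_lhs => rw [← posPart_sub_negPart (d i)]
        exact sub_smul (d i)⁺ (d i)⁻ (a i.1)
      rw [← hd, h2] at h1
      simp only [m]
      rw [eq_sub_iff_add_eq, add_right_comm, h1, sub_add_cancel]
    have hmD : m ∈ D := by
      refine ⟨fun x hx => ?_, fun x hx => ?_⟩
      · simp only [m, LinearMap.add_apply, LinearMap.sum_apply, LinearMap.smul_apply, smul_eq_mul]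
        have hx' := (hV x).1 hx
        refine add_le_add (mul_le_mul_of_nonneg_left ?_ (hlam j).le)
          (Finset.sum_le_sum fun i _ => mul_le_mul_of_nonneg_left ?_ (negPart_nonneg _))
        · linarith [hx' j.1, j.2.1]
        · exact (hSD i.1 i.2).1 x hx
      · rw [hm2]
        simp only [LinearMap.sub_apply, LinearMap.sum_apply, LinearMap.smul_apply, smul_eq_mul]
        have hx' := (hW x).1 hx
        refine sub_le_sub
          (Finset.sum_le_sum fun i _ => mul_le_mul_of_nonneg_left ?_ (posPart_nonneg _))
          (Finset.sum_le_sum fun i _ => mul_le_mul_of_nonneg_left ?_ (hlam i).le)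
        · exact (hSD i.1 i.2).2 x hx
        · have := hx' i.1
          rw [i.2.2, one_mul] at this
          linarith [i.2.1]
    have h3 : a j.1 = (lam j)⁻¹ • (m - ∑ i : S, (d i)⁻ • a i.1) := by
      simp only [m]
      rw [add_sub_cancel_right, inv_smul_smul₀ (hlam j).ne']
    rw [h3]
    refine Submodule.smul_mem _ _ (Submodule.sub_mem _ (Submodule.subset_span hmD) ?_)
    exact Submodule.sum_mem _ fun i _ => Submodule.smul_mem _ _
      (Submodule.subset_span (hSD i.1 i.2))
  intro φ hφ
  rw [Submodule.mem_dualAnnihilator] at hφ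
  have h5 : φ ∈ Submodule.span ℝ (Set.range fun i : {i : Fin b // a i x1 + c i = 0} => a i.1) := by
    apply mem_span_of_iInf_ker_le_ker
    intro v hv
    simp only [Submodule.mem_iInf, LinearMap.mem_ker] at hv ⊢
    obtain ⟨t, ht, hmem⟩ := hstep v (fun i hi => (hv ⟨i, hi⟩).ge) (fun i hi => hv ⟨i, hS i hi⟩)
    have h6 := hφ _ (AffineSubspace.vsub_mem_direction (subset_affineSpan ℝ _ hmem)
      (subset_affineSpan ℝ _ hx1))
    rw [vsub_eq_sub, add_sub_cancel_left, map_smul, smul_eq_mul] at h6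
    exact (mul_eq_zero.1 h6).resolve_left ht.ne'
  refine Submodule.span_le.2 ?_ h5
  rintro _ ⟨i, rfl⟩
  rcases hε i.1 with h | h
  · exact hJD ⟨i.1, i.2, h⟩
  · exact Submodule.subset_span (hSD i.1 h)

theorem chamber_sign {n b : ℕ} (π : Fin b → MvPolynomial (Fin n) ℝ)
    (a : Fin b → Module.Dual ℝ (Fin n → ℝ)) (c : Fin b → ℝ) (ha : ∀ i, a i ≠ 0)
    (hac : ∀ i x, eval x (π i) = a i x + c i) (θ : Fin b → SignType)
    (hcham : (interior (piece π θ)).Nonempty) (i : Fin b) : θ i ≠ 0 := by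
  intro h0
  obtain ⟨x, hx⟩ := hcham
  apply ha i
  have hpi : ∀ y ∈ piece π θ, a i y + c i = 0 := by
    intro y hy
    have := hy i
    rw [h0, sign_eq_zero_iff, hac] at this
    exact this
  ext j
  have hcont : Continuous fun t : ℝ => x + t • (Pi.single j 1 : Fin n → ℝ) := by fun_prop
  have hev : ∀ᶠ t : ℝ in nhdsWithin 0 (Set.Ioi 0),
      x + t • (Pi.single j 1 : Fin n → ℝ) ∈ interior (piece π θ) :=
    ((hcont.tendsto 0).eventually (isOpen_interior.mem_nhds (by simpa using hx))).filter_mono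
      nhdsWithin_le_nhds
  obtain ⟨t, ht, ht0⟩ := (hev.and self_mem_nhdsWithin).exists
  have h1 := hpi _ (interior_subset hx)
  have h2 := hpi _ (interior_subset ht)
  rw [map_add, map_smul, smul_eq_mul] at h2
  have h3 : t * a i (Pi.single j 1) = 0 := by linarith
  simpa using (mul_eq_zero.1 h3).resolve_left (ne_of_gt ht0)

theorem sign_pos_iff (s : SignType) (hs : s ≠ 0) (y : ℝ) :
    SignType.sign y = s ↔ 0 < (s : ℝ) * y := by
  rcases s with _ | _ | _
  · exact absurd rfl hs
  · rw [show SignType.neg = -1 from rfl, sign_eq_neg_one_iff]; simp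
  · rw [show SignType.pos = 1 from rfl, sign_eq_one_iff]; simp

theorem mem_closure_piece {n b : ℕ} (π : Fin b → MvPolynomial (Fin n) ℝ)
    (a : Fin b → Module.Dual ℝ (Fin n → ℝ)) (c : Fin b → ℝ)
    (hac : ∀ i x, eval x (π i) = a i x + c i) (θ : Fin b → SignType)
    (hθ : ∀ i, θ i ≠ 0) (hcham : (interior (piece π θ)).Nonempty) (x : Fin n → ℝ) :
    x ∈ closure (piece π θ) ↔ ∀ i, 0 ≤ ((θ i : SignType) : ℝ) * (a i x + c i) := by
  have hp : ∀ y, y ∈ piece π θ ↔ ∀ i, 0 < ((θ i : SignType) : ℝ) * (a i y + c i) := by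
    intro y
    refine forall_congr' fun i => ?_
    rw [sign_pos_iff _ (hθ i), hac]
  constructor
  · intro hx i
    have hcl : IsClosed {y : Fin n → ℝ | 0 ≤ ((θ i : SignType) : ℝ) * (a i y + c i)} := by
      have : Continuous (a i) := (a i).continuous_of_finiteDimensional
      exact isClosed_le continuous_const (by fun_prop)
    exact closure_minimal (fun y hy => ((hp y).1 hy i).le) hcl hx
  · intro hx
    obtain ⟨p, hpp⟩ := hcham
    replace hpp := (hp p).1 (interior_subset hpp)
    have hcont : Continuous fun t : ℝ => x + t • (p - x) := by fun_prop
    have htend : Filter.Tendsto (fun t : ℝ => x + t • (p - x)) (nhdsWithin 0 (Set.Ioi 0)) (nhds x) := by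
      have := (hcont.tendsto 0).mono_left (nhdsWithin_le_nhds (s := Set.Ioi 0))
      simpa using this
    refine mem_closure_of_tendsto htend ?_
    filter_upwards [Ioo_mem_nhdsGT (zero_lt_one (α := ℝ))] with t ht
    rw [hp]
    intro i
    have h1 : ((θ i : SignType) : ℝ) * (a i (x + t • (p - x)) + c i) =
        (1 - t) * (((θ i : SignType) : ℝ) * (a i x + c i))
          + t * (((θ i : SignType) : ℝ) * (a i p + c i)) := by
      rw [map_add, map_smul, map_sub, smul_eq_mul]; ring
    rw [h1]
    have h2 := mul_nonneg (sub_nonneg.2 ht.2.le) (hx i)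
    have h3 := mul_pos ht.1 (hpp i)
    linarith

/-- For closures `V`, `W` of two distinct chambers of a hyperplane partition
with `V ∩ W ≠ ∅` and `n'` the dimension of the affine span of `V ∩ W`, there
are `q ≤ n − n' + 1` degree-one polynomials, nonnegative on `V` and nonpositive
on `W`, generating the vanishing ideal of the affine span of `V ∩ W`. -/
theorem separating_generators_of_vanishing_ideal {n b : ℕ}
    (π : Fin b → MvPolynomial (Fin n) ℝ) (hπ : ∀ i, (π i).totalDegree = 1)
    (θ θ' : Fin b → SignType)
    (hcham : (interior (piece π θ)).Nonempty)
    (hcham' : (interior (piece π θ')).Nonempty)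
    (hne : piece π θ ≠ piece π θ')
    (V W : Set (Fin n → ℝ))
    (hV : V = closure (piece π θ)) (hW : W = closure (piece π θ'))
    (hVW : (V ∩ W).Nonempty)
    (n' : ℕ)
    (hn' : n' = Module.finrank ℝ (affineSpan ℝ (V ∩ W)).direction) :
    ∃ q : ℕ, q ≤ n - n' + 1 ∧ q ≤ n + 1 ∧
      ∃ π' : Fin q → MvPolynomial (Fin n) ℝ,
        (∀ k, (π' k).totalDegree = 1) ∧
        (∀ k, ∀ x ∈ V, 0 ≤ eval x (π' k)) ∧
        (∀ k, ∀ x ∈ W, eval x (π' k) ≤ 0) ∧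
        Ideal.span (Set.range π') =
          polyVanishingIdeal (affineSpan ℝ (V ∩ W) : Set (Fin n → ℝ)) := by
  classical
  choose a c ha hac using fun i => exists_affine_of_totalDegree (π i) (hπ i)
  have hθ := chamber_sign π a c ha hac θ hcham
  have hθ' := chamber_sign π a c ha hac θ' hcham'
  have hVm : ∀ x, x ∈ V ↔ ∀ i, 0 ≤ (((θ i : SignType) : ℝ) • a i) x + ((θ i : SignType) : ℝ) * c i := by
    intro x
    rw [hV, mem_closure_piece π a c hac θ hθ hcham]
    refine forall_congr' fun i => ?_
    rw [LinearMap.smul_apply, smul_eq_mul, mul_add]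
  have hsq : ∀ i, ((θ i : SignType) : ℝ) * ((θ i : SignType) : ℝ) = 1 := by
    intro i
    have := hθ i
    rcases h : θ i with _ | _ | _
    · exact absurd h this
    · simp
    · simp
  have hWm : ∀ x, x ∈ W ↔ ∀ i, 0 ≤ (((θ i : SignType) : ℝ) * ((θ' i : SignType) : ℝ)) *
      ((((θ i : SignType) : ℝ) • a i) x + ((θ i : SignType) : ℝ) * c i) := by
    intro x
    rw [hW, mem_closure_piece π a c hac θ' hθ' hcham']
    refine forall_congr' fun i => ?_
    have : (((θ i : SignType) : ℝ) * ((θ' i : SignType) : ℝ)) *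
      ((((θ i : SignType) : ℝ) • a i) x + ((θ i : SignType) : ℝ) * c i)
      = (((θ i : SignType) : ℝ) * ((θ i : SignType) : ℝ)) *
        (((θ' i : SignType) : ℝ) * (a i x + c i)) := by
      rw [LinearMap.smul_apply, smul_eq_mul]; ring
    rw [this, hsq, one_mul]
  have hε : ∀ i, ((θ i : SignType) : ℝ) * ((θ' i : SignType) : ℝ) = 1 ∨
      ((θ i : SignType) : ℝ) * ((θ' i : SignType) : ℝ) = -1 := by
    intro i
    have h1 := hθ i
    have h2 := hθ' i
    rcases h : θ i with _ | _ | _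
    · exact absurd h h1
    all_goals
      rcases h' : θ' i with _ | _ | _
      · exact absurd h' h2
      all_goals simp
  obtain ⟨x1, hx1, hle⟩ := core _ _ _ hε V W hVm hWm hVW
  set D := {l : Module.Dual ℝ (Fin n → ℝ) |
        (∀ x ∈ V, l x1 ≤ l x) ∧ ∀ x ∈ W, l x ≤ l x1} with hD
  have heq : Submodule.span ℝ D = (affineSpan ℝ (V ∩ W)).direction.dualAnnihilator := by
    refine le_antisymm (Submodule.span_le.2 fun l hl => ?_) hle
    rw [SetLike.mem_coe, Submodule.mem_dualAnnihilator]
    have : (affineSpan ℝ (V ∩ W)).direction ≤ LinearMap.ker l := by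
      rw [direction_affineSpan, vectorSpan_def, Submodule.span_le]
      rintro _ ⟨x, hx, y, hy, rfl⟩
      have h1 := hl.1 x hx.1
      have h2 := hl.2 x hx.2
      have h3 := hl.1 y hy.1
      have h4 := hl.2 y hy.2
      simp only [vsub_eq_sub, SetLike.mem_coe, LinearMap.mem_ker, map_sub]
      linarith
    exact fun w hw => this hw
  obtain ⟨l, hlD, hlspan, hlind⟩ := Submodule.exists_fun_fin_finrank_span_eq ℝ D
  have hdim := Subspace.finrank_add_finrank_dualAnnihilator_eq (affineSpan ℝ (V ∩ W)).direction
  rw [← heq, ← hn', Module.finrank_fin_fun] at hdim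
  refine ⟨_, by omega, by omega, fun k => affPoly (l k) x1, fun k => ?_, fun k x hx => ?_,
    fun k x hx => ?_, ?_⟩
  · exact totalDegree_affPoly _ _ (hlind.ne_zero k)
  · rw [eval_affPoly]; linarith [(hlD k).1 x hx]
  · rw [eval_affPoly]; linarith [(hlD k).2 x hx]
  · refine span_affPoly _ x1 l (hlspan.trans heq) _ fun x => ?_
    rw [← vsub_eq_sub]
    exact (AffineSubspace.vsub_right_mem_direction_iff_mem (subset_affineSpan ℝ _ hx1) x).symm
end

section
/- Let M be the smallest set of functions ℝⁿ → ℝ containing the coordinate functions x ↦ x_i (i = 1,…,n) and all constant functions, and closed under pointwise addition, pointwise multiplication, and pointwise maximum of two functions. Then every f ∈ M can be written as f(x) = max_{i=1,…,p} min_{j=1,…,p'} f_{ij}(x) for all x ∈ ℝⁿ, for some finitely many polynomials f_{ij} ∈ ℝ[x₁,…,x_n], 1 ≤ i ≤ p, 1 ≤ j ≤ p'. -/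
open MvPolynomial

/-- The max-definable functions `ℝⁿ → ℝ`: the smallest set of functions
containing the coordinate functions and the constant functions and closed
under pointwise addition, multiplication and maximization. -/
inductive MaxDefinable (n : ℕ) : ((Fin n → ℝ) → ℝ) → Prop
  | coord (i : Fin n) : MaxDefinable n (fun x => x i)
  | const (c : ℝ) : MaxDefinable n (fun _ => c)
  | add {f g : (Fin n → ℝ) → ℝ} :
      MaxDefinable n f → MaxDefinable n g → MaxDefinable n (fun x => f x + g x)
  | mul {f g : (Fin n → ℝ) → ℝ} :
      MaxDefinable n f → MaxDefinable n g → MaxDefinable n (fun x => f x * g x)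
  | max {f g : (Fin n → ℝ) → ℝ} :
      MaxDefinable n f → MaxDefinable n g →
        MaxDefinable n (fun x => max (f x) (g x))

/-- The lattice of functions generated by the polynomials. -/
inductive LatPoly (n : ℕ) : ((Fin n → ℝ) → ℝ) → Prop
  | poly (p : MvPolynomial (Fin n) ℝ) : LatPoly n (fun x => eval x p)
  | max {f g : (Fin n → ℝ) → ℝ} :
      LatPoly n f → LatPoly n g → LatPoly n (fun x => Max.max (f x) (g x))
  | min {f g : (Fin n → ℝ) → ℝ} :
      LatPoly n f → LatPoly n g → LatPoly n (fun x => Min.min (f x) (g x))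

namespace LatPoly

variable {n : ℕ} {f g : (Fin n → ℝ) → ℝ}

theorem congr (hf : LatPoly n f) (h : ∀ x, g x = f x) : LatPoly n g := by
  have : g = f := funext h
  rwa [this]

theorem zero : LatPoly n (fun _ => 0) :=
  (poly 0).congr (by simp)

theorem neg (hf : LatPoly n f) : LatPoly n (fun x => - f x) := by
  induction hf with
  | poly p => exact (poly (-p)).congr (by simp)
  | max _ _ h1 h2 => exact (h1.min h2).congr (fun x => by simp only [max_def, min_def]; grind)
  | min _ _ h1 h2 => exact (h1.max h2).congr (fun x => by simp only [max_def, min_def]; grind)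

theorem add_poly (hf : LatPoly n f) (q : MvPolynomial (Fin n) ℝ) :
    LatPoly n (fun x => f x + eval x q) := by
  induction hf with
  | poly p => exact (poly (p + q)).congr (by simp)
  | max _ _ h1 h2 => exact (h1.max h2).congr (fun x => by rw [max_add_add_right])
  | min _ _ h1 h2 => exact (h1.min h2).congr (fun x => by rw [min_add_add_right])

theorem add (hf : LatPoly n f) (hg : LatPoly n g) : LatPoly n (fun x => f x + g x) := by
  induction hg with
  | poly p => exact hf.add_poly p
  | max _ _ h1 h2 => exact (h1.max h2).congr (fun x => by rw [max_add_add_left])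
  | min _ _ h1 h2 => exact (h1.min h2).congr (fun x => by rw [min_add_add_left])

theorem pos_poly_poly (p q : MvPolynomial (Fin n) ℝ) :
    LatPoly n (fun x => Max.max (eval x p) 0 * Max.max (eval x q) 0) := by
  refine (zero.max ((poly (p * q)).min (poly (p * (1 + q ^ 2))))).congr (fun x => ?_)
  simp only [map_mul, map_add, map_one, map_pow]
  generalize eval x p = a
  generalize eval x q = b
  rcases le_total a 0 with ha | ha
  · rw [max_eq_right ha, zero_mul, max_eq_left]
    exact (min_le_right _ _).trans (mul_nonpos_of_nonpos_of_nonneg ha (by positivity))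
  · rcases le_total b 0 with hb | hb
    · rw [max_eq_right hb, mul_zero, max_eq_left]
      exact (min_le_left _ _).trans (mul_nonpos_of_nonneg_of_nonpos ha hb)
    · rw [max_eq_left ha, max_eq_left hb, min_eq_left, max_eq_right (mul_nonneg ha hb)]
      exact mul_le_mul_of_nonneg_left (by nlinarith [sq_nonneg (b - 1)]) ha

theorem max_pos_mul (a b c : ℝ) : Max.max (Max.max a b) 0 * Max.max c 0 =
    Max.max (Max.max a 0 * Max.max c 0) (Max.max b 0 * Max.max c 0) := by
  rw [← max_mul_of_nonneg _ _ (le_max_right c 0), max_max_max_comm, max_self]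

theorem min_pos_mul (a b c : ℝ) : Max.max (Min.min a b) 0 * Max.max c 0 =
    Min.min (Max.max a 0 * Max.max c 0) (Max.max b 0 * Max.max c 0) := by
  rw [← min_mul_of_nonneg _ _ (le_max_right c 0), max_min_distrib_right]

theorem pos_poly (hf : LatPoly n f) (q : MvPolynomial (Fin n) ℝ) :
    LatPoly n (fun x => Max.max (f x) 0 * Max.max (eval x q) 0) := by
  induction hf with
  | poly p => exact pos_poly_poly p q
  | max _ _ h1 h2 => exact (h1.max h2).congr (fun x => max_pos_mul _ _ _)
  | min _ _ h1 h2 => exact (h1.min h2).congr (fun x => min_pos_mul _ _ _)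

theorem pos_mul (hf : LatPoly n f) (hg : LatPoly n g) :
    LatPoly n (fun x => Max.max (f x) 0 * Max.max (g x) 0) := by
  induction hg with
  | poly p => exact hf.pos_poly p
  | max _ _ h1 h2 =>
    refine (h1.max h2).congr (fun x => ?_)
    rw [mul_comm, max_pos_mul, mul_comm, mul_comm (Max.max (f x) 0)]
    simp only [mul_comm]
  | min _ _ h1 h2 =>
    refine (h1.min h2).congr (fun x => ?_)
    rw [mul_comm, min_pos_mul]
    simp only [mul_comm]

theorem mul (hf : LatPoly n f) (hg : LatPoly n g) : LatPoly n (fun x => f x * g x) := by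
  refine (((hf.pos_mul hg).add (hf.neg.pos_mul hg.neg)).add
    ((hf.pos_mul hg.neg).add (hf.neg.pos_mul hg)).neg).congr (fun x => ?_)
  have h (a : ℝ) : a = Max.max a 0 - Max.max (-a) 0 := by
    rcases le_total a 0 with h | h <;> simp [h]
  conv_lhs => rw [h (f x), h (g x)]
  ring

theorem dnf (hf : LatPoly n f) : ∃ (ι κ : Type) (_ : Fintype ι) (_ : Fintype κ)
    (_ : Nonempty ι) (_ : Nonempty κ) (F : ι → κ → MvPolynomial (Fin n) ℝ),
    ∀ x c, c ≤ f x ↔ ∃ i, ∀ j, c ≤ eval x (F i j) := by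
  induction hf with
  | poly p =>
    exact ⟨Unit, Unit, inferInstance, inferInstance, inferInstance, inferInstance,
      fun _ _ => p, by simp⟩
  | max _ _ h1 h2 =>
    obtain ⟨ι, κ, _, _, _, _, F, hF⟩ := h1
    obtain ⟨ι', κ', _, _, _, _, G, hG⟩ := h2
    refine ⟨ι ⊕ ι', κ × κ', inferInstance, inferInstance, inferInstance, inferInstance,
      fun i j => Sum.elim (fun i => F i j.1) (fun i => G i j.2) i, fun x c => ?_⟩
    simp [hF, hG]
  | min _ _ h1 h2 =>
    obtain ⟨ι, κ, _, _, _, _, F, hF⟩ := h1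
    obtain ⟨ι', κ', _, _, _, _, G, hG⟩ := h2
    refine ⟨ι × ι', κ ⊕ κ', inferInstance, inferInstance, inferInstance, inferInstance,
      fun i j => Sum.elim (fun j => F i.1 j) (fun j => G i.2 j) j, fun x c => ?_⟩
    simp [hF, hG]

end LatPoly

theorem MaxDefinable.latPoly {n : ℕ} {f : (Fin n → ℝ) → ℝ} (hf : MaxDefinable n f) :
    LatPoly n f := by
  induction hf with
  | coord i => exact (LatPoly.poly (X i)).congr (by simp)
  | const c => exact (LatPoly.poly (C c)).congr (by simp)
  | add _ _ h1 h2 => exact h1.add h2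
  | mul _ _ h1 h2 => exact h1.mul h2
  | max _ _ h1 h2 => exact h1.max h2

/-- Every max-definable function is a max-min of finitely many polynomials. -/
theorem maxDefinable_eq_maxmin_of_polynomials {n : ℕ}
    (f : (Fin n → ℝ) → ℝ) (hf : MaxDefinable n f) :
    ∃ (p p' : ℕ) (F : Fin (p + 1) → Fin (p' + 1) → MvPolynomial (Fin n) ℝ),
      ∀ x : Fin n → ℝ,
        f x = Finset.univ.sup' Finset.univ_nonempty (fun i =>
          Finset.univ.inf' Finset.univ_nonempty (fun j => eval x (F i j))) := by
  obtain ⟨ι, κ, _, _, _, _, F, hF⟩ := hf.latPoly.dnf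
  obtain ⟨p, hp⟩ := Nat.exists_eq_succ_of_ne_zero (Fintype.card_ne_zero (α := ι))
  obtain ⟨p', hp'⟩ := Nat.exists_eq_succ_of_ne_zero (Fintype.card_ne_zero (α := κ))
  let e := (Fintype.equivFinOfCardEq hp).symm
  let e' := (Fintype.equivFinOfCardEq hp').symm
  refine ⟨p, p', fun i j => F (e i) (e' j), fun x => ?_⟩
  refine eq_of_forall_le_iff (fun c => ?_)
  rw [hF, Finset.le_sup'_iff]
  simp only [Finset.le_inf'_iff, Finset.mem_univ, true_and, forall_true_left]
  constructor
  · rintro ⟨i, hi⟩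
    exact ⟨e.symm i, fun j => by simpa using hi (e' j)⟩
  · rintro ⟨i, hi⟩
    exact ⟨e i, fun j => by simpa using hi (e'.symm j)⟩
end

section
/- Let π₁,…,π_b ∈ ℝ[x₁,…,x_n] be nonconstant polynomials (of arbitrary degree) inducing a semialgebraic partition of ℝⁿ, let Π₁,…,Π_p be the chambers of this partition, let V_i be the Euclidean closure of Π_i for i = 1,…,p, and assume V₁ ∪ ⋯ ∪ V_p = ℝⁿ. Let f : ℝⁿ → ℝ be continuous and suppose that for each nonempty piece Π_θ there is a polynomial g_θ with f = g_θ on Π_θ; write g_i for the polynomial with f = g_i on Π_i. If g_i − g_j ∈ ⟨V_i, V_j⟩ for all i, j ∈ {1,…,p}, then f can be written as f(x) = max_{i=1,…,P} min_{j=1,…,P'} f_{ij}(x) for all x ∈ ℝⁿ, for some finitely many polynomials f_{ij} ∈ ℝ[x₁,…,x_n]. -/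
open MvPolynomial

/-- Elements of the separating ideal are dominated on `U` by a polynomial that is `≤ 0` on `V`. -/
lemma sepIdeal_dominate {n : ℕ} (U V : Set (Fin n → ℝ)) (d : MvPolynomial (Fin n) ℝ)
    (hd : d ∈ sepIdeal U V) :
    ∃ u : MvPolynomial (Fin n) ℝ, (∀ x ∈ U, |eval x d| ≤ eval x u) ∧ ∀ x ∈ V, eval x u ≤ 0 := by
  unfold sepIdeal at hd
  induction hd using Submodule.span_induction with
  | mem h hh => exact ⟨h, fun x hx => (abs_of_nonneg (hh.1 x hx)).le, hh.2⟩
  | zero => exact ⟨0, by simp, by simp⟩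
  | add a c _ _ ha hc =>
    obtain ⟨u, hu1, hu2⟩ := ha
    obtain ⟨v, hv1, hv2⟩ := hc
    refine ⟨u + v, fun x hx => ?_, fun x hx => ?_⟩
    · rw [map_add, map_add]
      exact (abs_add_le _ _).trans (add_le_add (hu1 x hx) (hv1 x hx))
    · rw [map_add]
      exact add_nonpos (hu2 x hx) (hv2 x hx)
  | smul a c _ hc =>
    obtain ⟨u, hu1, hu2⟩ := hc
    refine ⟨(1 + a ^ 2) * u, fun x hx => ?_, fun x hx => ?_⟩
    · simp only [smul_eq_mul, map_mul, map_add, map_one, map_pow, abs_mul]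
      have h1 : |eval x a| ≤ 1 + eval x a ^ 2 := by
        rw [← sq_abs]
        nlinarith [sq_nonneg (|eval x a| - 1), abs_nonneg (eval x a)]
      exact mul_le_mul h1 (hu1 x hx) (abs_nonneg _) (by positivity)
    · simp only [map_mul, map_add, map_one, map_pow]
      exact mul_nonpos_of_nonneg_of_nonpos (by positivity) (hu2 x hx)

/-- Corollary of Madden's theorem: if a semialgebraic spline `f` restricts to
`gᵢ` on the chambers `Πᵢ` (whose closures `Vᵢ` cover `ℝⁿ`) and
`gᵢ − gⱼ ∈ ⟨Vᵢ, Vⱼ⟩` for all `i, j`, then `f` is a max-min of finitely many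
polynomials. -/
theorem maxmin_of_sepIdeal_membership {n b p : ℕ}
    (π : Fin b → MvPolynomial (Fin n) ℝ) (hπ : ∀ i, 0 < (π i).totalDegree)
    (Θ : Fin p → (Fin b → SignType))
    (hcham : ∀ i, (interior (piece π (Θ i))).Nonempty)
    (hall : ∀ θ : Fin b → SignType, (interior (piece π θ)).Nonempty →
      ∃ i, piece π θ = piece π (Θ i))
    (V : Fin p → Set (Fin n → ℝ)) (hV : ∀ i, V i = closure (piece π (Θ i)))
    (hcover : (⋃ i, V i) = Set.univ)
    (f : (Fin n → ℝ) → ℝ) (hcont : Continuous f)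
    (hpoly : ∀ θ : Fin b → SignType, (piece π θ).Nonempty →
      ∃ gθ : MvPolynomial (Fin n) ℝ, ∀ x ∈ piece π θ, f x = eval x gθ)
    (g : Fin p → MvPolynomial (Fin n) ℝ)
    (hg : ∀ i, ∀ x ∈ piece π (Θ i), f x = eval x (g i))
    (hsep : ∀ i j, g i - g j ∈ sepIdeal (V i) (V j)) :
    ∃ (P P' : ℕ) (F : Fin (P + 1) → Fin (P' + 1) → MvPolynomial (Fin n) ℝ),
      ∀ x : Fin n → ℝ,
        f x = Finset.univ.sup' Finset.univ_nonempty (fun i =>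
          Finset.univ.inf' Finset.univ_nonempty (fun j => eval x (F i j))) := by
  have hfV : ∀ i, ∀ x ∈ V i, f x = eval x (g i) := by
    intro i x hx
    rw [hV i] at hx
    have hcl : IsClosed {y | f y = eval y (g i)} :=
      isClosed_eq hcont (MvPolynomial.continuous_eval (g i))
    exact closure_minimal (hg i) hcl hx
  have hmem : ∀ x, ∃ i, x ∈ V i := fun x => by
    have : x ∈ ⋃ i, V i := by rw [hcover]; trivial
    simpa using this
  choose u hu1 hu2 using fun i j => sepIdeal_dominate (V i) (V j) _ (hsep i j)
  obtain ⟨i0, -⟩ := hmem 0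
  obtain ⟨q, rfl⟩ : ∃ q, p = q + 1 := ⟨p - 1, by have := i0.2; omega⟩
  refine ⟨q, q, fun i j => g j + u i j, fun x => le_antisymm ?_ ?_⟩
  · obtain ⟨i, hi⟩ := hmem x
    refine le_trans ?_ (Finset.le_sup' _ (Finset.mem_univ i))
    refine Finset.le_inf' _ _ fun j _ => ?_
    have h1 := (le_abs_self _).trans (hu1 i j x hi)
    rw [map_sub] at h1
    rw [hfV i x hi, map_add]
    linarith
  · refine Finset.sup'_le _ _ fun i _ => ?_
    obtain ⟨j, hj⟩ := hmem x
    refine le_trans (Finset.inf'_le _ (Finset.mem_univ j)) ?_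
    have h1 := hu2 i j x hj
    rw [hfV j x hj, map_add]
    linarith
end
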